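/- arXiv:1804.06983 — 2 statements merged into one kernel-verified Lean document; each statement's English description precedes it below -/
import Mathlib

section
/- Let X be an Asplund space and let φ : X → ℝ ∪ {+∞} be a proper lower semicontinuous function that is finite at two given points a ≠ b. Then there exists a point c ∈ [a,b) at which the function ψ(x) := φ(x) − (φ(b) − φ(a))/‖a − b‖ · ‖x − a‖ attains its minimum over the segment [a,b]; moreover, for any such c there exist sequences (x_k) in X and (x_k*) in X* with x_k* ∈ ∂̂φ(x_k) for every k, such that x_k → c, φ(x_k) → φ(c), and (i) liminf_{k→∞} ⟨x_k*, b − x_k⟩ ≥ (φ(b) − φ(a))/‖a − b‖ · ‖b − c‖, (ii) liminf_{k→∞} ⟨x_k*, b − a⟩ ≥ φ(b) − φ(a), and (iii) if c ≠ a, then lim_{k→∞} ⟨x_k*, b − a⟩ = φ(b) − φ(a). -/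
open Filter Topology

/-- `X` is an Asplund space: every closed separable subspace has separable dual. -/
def IsAsplund (X : Type*) [NormedAddCommGroup X] [NormedSpace ℝ X] : Prop :=
  ∀ Y : Submodule ℝ X, IsClosed (Y : Set X) →
    TopologicalSpace.SeparableSpace Y →
    TopologicalSpace.SeparableSpace (StrongDual ℝ Y)

/-- Quasiconvexity of an extended-real-valued function. -/
def QuasiconvexFn {X : Type*} [AddCommGroup X] [Module ℝ X] (φ : X → EReal) : Prop :=
  ∀ x y : X, ∀ l : ℝ, 0 < l → l < 1 → φ (l • x + (1 - l) • y) ≤ max (φ x) (φ y)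

/-- The Fréchet subdifferential of `φ` at `x`. -/
def FrechetSubdiff {X : Type*} [NormedAddCommGroup X] [NormedSpace ℝ X]
    (φ : X → EReal) (x : X) : Set (X →L[ℝ] ℝ) :=
  {xs | φ x ≠ ⊤ ∧ ∀ ε : ℝ, 0 < ε →
    ∀ᶠ y in 𝓝 x, φ x + ↑(xs (y - x)) - ↑(ε * ‖y - x‖) ≤ φ y}

/-- `φ` is `α`-robustly quasiconvex. -/
def RobustlyQuasiconvex {X : Type*} [NormedAddCommGroup X] [NormedSpace ℝ X]
    (φ : X → EReal) (α : ℝ) : Prop :=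
  ∀ vs : X →L[ℝ] ℝ, ‖vs‖ ≤ α → QuasiconvexFn (fun z => φ z + ↑(vs z))

section AmvSmooth

variable {E : Type*} [NormedAddCommGroup E] [NormedSpace ℝ E]

noncomputable def amvW (g : ℕ → StrongDual ℝ E) (n : ℕ) : Submodule ℝ E :=
  ⨅ i : Fin n, LinearMap.ker ((g i : StrongDual ℝ E) : E →ₗ[ℝ] ℝ)

noncomputable def amvS (g : ℕ → StrongDual ℝ E) (n : ℕ) (f : StrongDual ℝ E) : ℝ :=
  ‖f.comp (amvW g n).subtypeL‖

lemma amvW_mem (g : ℕ → StrongDual ℝ E) (n : ℕ) (x : E) :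
    x ∈ amvW g n ↔ ∀ i : Fin n, g i x = 0 := by
  simp [amvW]

lemma amvS_nonneg (g : ℕ → StrongDual ℝ E) (n : ℕ) (f : StrongDual ℝ E) : 0 ≤ amvS g n f :=
  ContinuousLinearMap.opNorm_nonneg _

lemma amvS_le (g : ℕ → StrongDual ℝ E) (n : ℕ) (f : StrongDual ℝ E) : amvS g n f ≤ ‖f‖ := by
  refine ContinuousLinearMap.opNorm_le_bound _ (norm_nonneg _) fun x => ?_
  exact f.le_opNorm x

lemma amvS_apply (g : ℕ → StrongDual ℝ E) (n : ℕ) (f : StrongDual ℝ E) (x : E)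
    (hx : x ∈ amvW g n) : |f x| ≤ amvS g n f * ‖x‖ :=
  (f.comp (amvW g n).subtypeL).le_opNorm ⟨x, hx⟩

lemma amvS_le_bound (g : ℕ → StrongDual ℝ E) (n : ℕ) (f : StrongDual ℝ E) (C : ℝ) (hC : 0 ≤ C)
    (h : ∀ x ∈ amvW g n, |f x| ≤ C * ‖x‖) : amvS g n f ≤ C :=
  ContinuousLinearMap.opNorm_le_bound _ hC fun x => h x x.2

lemma amvS_zero (g : ℕ → StrongDual ℝ E) (f : StrongDual ℝ E) : amvS g 0 f = ‖f‖ := by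
  refine le_antisymm (amvS_le g 0 f) ?_
  refine ContinuousLinearMap.opNorm_le_bound _ (amvS_nonneg g 0 f) fun x => ?_
  exact amvS_apply g 0 f x ((amvW_mem g 0 x).2 fun i => i.elim0)

lemma amvS_add (g : ℕ → StrongDual ℝ E) (n : ℕ) (f f' : StrongDual ℝ E) :
    amvS g n (f + f') ≤ amvS g n f + amvS g n f' := by
  refine amvS_le_bound _ _ _ _ (add_nonneg (amvS_nonneg g n f) (amvS_nonneg g n f')) fun x hx => ?_
  have h1 := amvS_apply g n f x hx
  have h2 := amvS_apply g n f' x hx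
  have h3 := abs_add_le (f x) (f' x)
  rw [add_apply]
  linarith

lemma amvS_sub (g : ℕ → StrongDual ℝ E) (n : ℕ) (f f' : StrongDual ℝ E) :
    amvS g n (f - f') ≤ amvS g n f + amvS g n f' := by
  refine amvS_le_bound _ _ _ _ (add_nonneg (amvS_nonneg g n f) (amvS_nonneg g n f')) fun x hx => ?_
  have h1 := amvS_apply g n f x hx
  have h2 := amvS_apply g n f' x hx
  have h3 := abs_sub (f x) (f' x)
  rw [sub_apply]
  linarith

lemma amvS_half (g : ℕ → StrongDual ℝ E) (n : ℕ) (f : StrongDual ℝ E) :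
    amvS g n ((1 / 2 : ℝ) • f) ≤ 1 / 2 * amvS g n f := by
  refine amvS_le_bound _ _ _ _ (mul_nonneg (by norm_num) (amvS_nonneg g n f)) fun x hx => ?_
  have h1 := amvS_apply g n f x hx
  rw [smul_apply, smul_eq_mul, abs_mul, abs_of_pos (by norm_num : (0 : ℝ) < 1 / 2)]
  linarith

lemma amvS_small (g : ℕ → StrongDual ℝ E) (hg : DenseRange g) (f : StrongDual ℝ E) (ε : ℝ)
    (hε : 0 < ε) : ∃ n, amvS g n f < ε := by
  obtain ⟨k, hk⟩ := hg.exists_dist_lt f hε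
  refine ⟨k + 1, lt_of_le_of_lt ?_ hk⟩
  refine amvS_le_bound _ _ _ _ dist_nonneg fun x hx => ?_
  have h0 := (amvW_mem _ _ _).1 hx ⟨k, Nat.lt_succ_self k⟩
  have : f x = (f - g k) x := by
    rw [sub_apply]
    have h0' : g k x = 0 := h0
    rw [h0', sub_zero]
  rw [this, dist_eq_norm]
  exact (f - g k).le_opNorm x

lemma amvS_decomp (g : ℕ → StrongDual ℝ E) (n : ℕ) (f : StrongDual ℝ E) :
    ∃ h ∈ Submodule.span ℝ (Set.range fun i : Fin n => g i), ‖f - h‖ ≤ amvS g n f := by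
  obtain ⟨e, he, hn⟩ := exists_extension_norm_eq (amvW g n) (f.comp (amvW g n).subtypeL)
  refine ⟨f - e, ?_, by simpa [amvS] using hn.le⟩
  have h1 : ((f - e : StrongDual ℝ E) : E →ₗ[ℝ] ℝ) ∈ Submodule.span ℝ
      (Set.range fun i : Fin n => ((g i : StrongDual ℝ E) : E →ₗ[ℝ] ℝ)) := by
    apply mem_span_of_iInf_ker_le_ker
    intro x hx
    have := he ⟨x, hx⟩
    simp at this
    simp [this]
  rw [Submodule.mem_span_range_iff_exists_fun] at h1 ⊢
  obtain ⟨c, hc⟩ := h1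
  refine ⟨c, ?_⟩
  ext x
  have := congrArg (fun l : E →ₗ[ℝ] ℝ => l x) hc
  simpa using this

lemma amv_tight (g : ℕ → StrongDual ℝ E) (hg : DenseRange g)
    (U : Ultrafilter (StrongDual ℝ E)) (f0 : StrongDual ℝ E) (R : ℝ)
    (hb : ∀ᶠ f in (U : Filter (StrongDual ℝ E)), ‖f‖ ≤ R)
    (hp : ∀ x, Tendsto (fun f : StrongDual ℝ E => f x) U (𝓝 (f0 x)))
    (hs : ∀ n, Tendsto (amvS g n) U (𝓝 (amvS g n f0))) :
    (U : Filter (StrongDual ℝ E)) ≤ 𝓝 f0 := by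
  rw [Metric.nhds_basis_ball.ge_iff]
  intro ε' hε'
  obtain ⟨ε, hε, rfl⟩ : ∃ ε : ℝ, 0 < ε ∧ ε' = 5 * ε := ⟨ε' / 5, by positivity, by ring⟩
  obtain ⟨n, hn⟩ := amvS_small g hg f0 ε hε
  have hn' : ∀ᶠ f in (U : Filter (StrongDual ℝ E)), amvS g n f < ε := (hs n).eventually_lt_const hn
  choose H hH1 hH2 using fun f : StrongDual ℝ E => amvS_decomp g n (f - f0)
  set F := Submodule.span ℝ (Set.range fun i : Fin n => g i) with hF
  have hF2 : FiniteDimensional ℝ F := FiniteDimensional.span_of_finite ℝ (Set.finite_range _)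
  have hF3 : ProperSpace F := FiniteDimensional.proper ℝ F
  have hcl : ∀ᶠ f in (U : Filter (StrongDual ℝ E)), ‖f - f0 - H f‖ ≤ 2 * ε := by
    filter_upwards [hn'] with f hf
    have := hH2 f
    have := amvS_sub g n f f0
    linarith
  set B := R + ‖f0‖ + 2 * ε
  have hK : IsCompact ((fun x : F => (x : StrongDual ℝ E)) '' Metric.closedBall (0 : F) B) :=
    (isCompact_closedBall _ _).image continuous_subtype_val
  obtain ⟨h, -, hh⟩ := hK.ultrafilter_le_nhds (U.map H) (by
    rw [le_principal_iff, Ultrafilter.coe_map, mem_map]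
    filter_upwards [hb, hcl] with f h1 h2
    refine ⟨⟨H f, hH1 f⟩, ?_, rfl⟩
    rw [Metric.mem_closedBall, Subtype.dist_eq]
    change dist (H f) 0 ≤ _
    rw [dist_zero_right]
    have : H f = f - f0 - (f - f0 - H f) := by abel
    rw [this]
    have := norm_sub_le (f - f0) (f - f0 - H f)
    have := norm_sub_le f f0
    linarith)
  have hh' : Tendsto H U (𝓝 h) := hh
  have hhn : ‖h‖ ≤ 2 * ε := by
    refine ContinuousLinearMap.opNorm_le_bound _ (by positivity) fun x => ?_
    have t1 : Tendsto (fun f : StrongDual ℝ E => (f - f0 - H f) x) U (𝓝 (f0 x - f0 x - h x)) := by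
      have : Tendsto (fun f => H f x) U (𝓝 (h x)) :=
        ((ContinuousLinearMap.apply ℝ ℝ x).continuous.tendsto h).comp hh'
      simpa using ((hp x).sub_const (f0 x)).sub this
    have t2 := t1.norm
    rw [sub_self, zero_sub, norm_neg] at t2
    refine le_of_tendsto t2 ?_
    filter_upwards [hcl] with f hf
    exact ((f - f0 - H f).le_opNorm x).trans (by gcongr)
  filter_upwards [hcl, hh'.eventually (Metric.ball_mem_nhds h hε)] with f h1 h2
  rw [Metric.mem_ball]
  rw [dist_eq_norm] at h2 ⊢
  have : f - f0 = (f - f0 - H f) + (H f - h) + h := by abel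
  rw [this]
  have := norm_add_le ((f - f0 - H f) + (H f - h)) h
  have := norm_add_le (f - f0 - H f) (H f - h)
  linarith

lemma amv_weakstar (U : Ultrafilter (StrongDual ℝ E)) (R : ℝ)
    (hb : ∀ᶠ f in (U : Filter (StrongDual ℝ E)), ‖f‖ ≤ R) :
    ∃ f0 : StrongDual ℝ E, ∀ x, Tendsto (fun f : StrongDual ℝ E => f x) U (𝓝 (f0 x)) := by
  obtain ⟨w, -, hw⟩ := (WeakDual.isCompact_closedBall (𝕜 := ℝ) (E := E) 0 R).ultrafilter_le_nhds
    (U.map StrongDual.toWeakDual) (by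
      rw [le_principal_iff, Ultrafilter.coe_map, mem_map]
      filter_upwards [hb] with f hf
      simpa using hf)
  refine ⟨WeakDual.toStrongDual w, fun x => ?_⟩
  have h1 : Tendsto (fun v : WeakDual ℝ E => v x) (𝓝 w) (𝓝 (w x)) :=
    (WeakDual.eval_continuous x).tendsto w
  exact h1.comp hw

noncomputable def amvT (g : ℕ → StrongDual ℝ E) (a : ℕ → E) (f : StrongDual ℝ E) (n : ℕ) : ℝ :=
  (1 / 2) ^ n * ((amvS g n f) ^ 2 + (f (a n)) ^ 2)

noncomputable def amvP (g : ℕ → StrongDual ℝ E) (a : ℕ → E) (f : StrongDual ℝ E) : ℝ :=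
  ∑' n, amvT g a f n

lemma amvT_nonneg (g : ℕ → StrongDual ℝ E) (a : ℕ → E) (f : StrongDual ℝ E) (n : ℕ) :
    0 ≤ amvT g a f n := by unfold amvT; positivity

lemma amvT_le (g : ℕ → StrongDual ℝ E) (a : ℕ → E) (ha : ∀ n, ‖a n‖ ≤ 1)
    (f : StrongDual ℝ E) (n : ℕ) : amvT g a f n ≤ (1 / 2) ^ n * (2 * ‖f‖ ^ 2) := by
  unfold amvT
  have h1 := amvS_le g n f
  have h0 := amvS_nonneg g n f
  have h2 : |f (a n)| ≤ ‖f‖ := (f.le_opNorm (a n)).trans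
    (mul_le_of_le_one_right (norm_nonneg _) (ha n))
  have h3 : (f (a n)) ^ 2 ≤ ‖f‖ ^ 2 := by
    rw [← sq_abs (f (a n))]; gcongr
  have h4 : (amvS g n f) ^ 2 ≤ ‖f‖ ^ 2 := by gcongr
  gcongr
  linarith

lemma amvT_summable (g : ℕ → StrongDual ℝ E) (a : ℕ → E) (ha : ∀ n, ‖a n‖ ≤ 1)
    (f : StrongDual ℝ E) : Summable (amvT g a f) :=
  Summable.of_nonneg_of_le (amvT_nonneg g a f) (amvT_le g a ha f)
    (summable_geometric_two.mul_right _)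

lemma amvP_le (g : ℕ → StrongDual ℝ E) (a : ℕ → E) (ha : ∀ n, ‖a n‖ ≤ 1)
    (f : StrongDual ℝ E) : amvP g a f ≤ 4 * ‖f‖ ^ 2 := by
  have h := (amvT_summable g a ha f).tsum_le_tsum (amvT_le g a ha f)
    (summable_geometric_two.mul_right _)
  rw [tsum_mul_right, tsum_geometric_two] at h
  unfold amvP
  linarith

lemma amvP_ge (g : ℕ → StrongDual ℝ E) (a : ℕ → E) (ha : ∀ n, ‖a n‖ ≤ 1)
    (f : StrongDual ℝ E) : ‖f‖ ^ 2 ≤ amvP g a f := by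
  have h := (amvT_summable g a ha f).le_tsum 0 (fun j _ => amvT_nonneg g a f j)
  refine le_trans ?_ h
  simp only [amvT, amvS_zero, pow_zero, one_mul]
  nlinarith [sq_nonneg (f (a 0))]

lemma amvP_gap (g : ℕ → StrongDual ℝ E) (a : ℕ → E) (ha : ∀ n, ‖a n‖ ≤ 1)
    (f f' : StrongDual ℝ E) (n : ℕ) :
    (1 / 2) ^ n * ((amvS g n f - amvS g n f') ^ 2 / 4 + (f (a n) - f' (a n)) ^ 2 / 4) ≤
      amvP g a f / 2 + amvP g a f' / 2 - amvP g a ((1 / 2 : ℝ) • (f + f')) := by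
  have s1 := (amvT_summable g a ha f).div_const 2
  have s2 := (amvT_summable g a ha f').div_const 2
  have s3 := amvT_summable g a ha ((1 / 2 : ℝ) • (f + f'))
  have key : ∀ k, (1 / 2) ^ k * ((amvS g k f - amvS g k f') ^ 2 / 4 + (f (a k) - f' (a k)) ^ 2 / 4)
      ≤ amvT g a f k / 2 + amvT g a f' k / 2 - amvT g a ((1 / 2 : ℝ) • (f + f')) k := by
    intro k
    unfold amvT
    have hh := amvS_half g k (f + f')
    have hh0 := amvS_nonneg g k ((1 / 2 : ℝ) • (f + f'))
    have h1 := amvS_add g k f f'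
    have h0 := amvS_nonneg g k (f + f')
    have h2 : (amvS g k (f + f')) ^ 2 ≤ (amvS g k f + amvS g k f') ^ 2 := by gcongr
    have hw : (0 : ℝ) < (1 / 2) ^ k := by positivity
    have h3 : (amvS g k ((1 / 2 : ℝ) • (f + f'))) ^ 2 ≤ (1 / 2 * amvS g k (f + f')) ^ 2 := by gcongr
    simp only [smul_apply, add_apply, smul_eq_mul]
    have : (amvS g k f - amvS g k f') ^ 2 / 4 + (f (a k) - f' (a k)) ^ 2 / 4 ≤
      ((amvS g k f) ^ 2 + (f (a k)) ^ 2) / 2 + ((amvS g k f') ^ 2 + (f' (a k)) ^ 2) / 2 -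
        ((amvS g k ((1 / 2 : ℝ) • (f + f'))) ^ 2 + (1 / 2 * (f (a k) + f' (a k))) ^ 2) := by
      nlinarith
    nlinarith [mul_le_mul_of_nonneg_left this hw.le]
  have h := ((s1.add s2).sub s3).le_tsum n (fun j _ => le_trans (by positivity) (key j))
  refine (key n).trans (h.trans (le_of_eq ?_))
  rw [(s1.add s2).tsum_sub s3, s1.tsum_add s2, tsum_div_const, tsum_div_const]
  rfl

/-- lower semicontinuity along pointwise convergent bounded ultrafilters -/
lemma amvP_lsc (g : ℕ → StrongDual ℝ E) (a : ℕ → E)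
    (ha : ∀ n, ‖a n‖ ≤ 1) (U : Ultrafilter (StrongDual ℝ E)) (f0 : StrongDual ℝ E) (R L : ℝ)
    (hb : ∀ᶠ f in (U : Filter (StrongDual ℝ E)), ‖f‖ ≤ R)
    (hp : ∀ x, Tendsto (fun f : StrongDual ℝ E => f x) U (𝓝 (f0 x)))
    (hL : Tendsto (amvP g a) U (𝓝 L)) : amvP g a f0 ≤ L := by
  have hσ : ∀ n, ∃ σ, 0 ≤ σ ∧ Tendsto (amvS g n) U (𝓝 σ) := by
    intro n
    obtain ⟨σ, hσ, h⟩ := (isCompact_Icc (a := (0 : ℝ)) (b := R)).ultrafilter_le_nhds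
      (U.map (amvS g n)) (by
        rw [le_principal_iff, Ultrafilter.coe_map, mem_map]
        filter_upwards [hb] with f hf
        exact ⟨amvS_nonneg _ _ _, (amvS_le _ _ _).trans hf⟩)
    exact ⟨σ, hσ.1, h⟩
  choose σ hσ0 hσ using hσ
  have hle : ∀ n, amvS g n f0 ≤ σ n := by
    intro n
    refine amvS_le_bound _ _ _ _ (hσ0 n) fun x hx => ?_
    exact le_of_tendsto_of_tendsto' (hp x).abs ((hσ n).mul_const ‖x‖)
      fun f => amvS_apply g n f x hx
  refine Real.tsum_le_of_sum_range_le (amvT_nonneg g a f0) fun N => ?_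
  have h1 : Tendsto (fun f => ∑ i ∈ Finset.range N, amvT g a f i) U
      (𝓝 (∑ i ∈ Finset.range N, (1 / 2) ^ i * ((σ i) ^ 2 + (f0 (a i)) ^ 2))) :=
    tendsto_finsetSum _ fun i _ => (((hσ i).pow 2).add ((hp (a i)).pow 2)).const_mul _
  have h2 := le_of_tendsto_of_tendsto' h1 hL fun f =>
    (amvT_summable g a ha f).sum_le_tsum _ (fun j _ => amvT_nonneg g a f j)
  refine le_trans (Finset.sum_le_sum fun i _ => ?_) h2
  unfold amvT
  have := amvS_nonneg g i f0
  have := hle i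
  gcongr

lemma amv_max_exists (g : ℕ → StrongDual ℝ E) (a : ℕ → E)
    (ha : ∀ n, ‖a n‖ ≤ 1) (x : E) :
    ∃ f0 : StrongDual ℝ E, ∀ f : StrongDual ℝ E, f x - amvP g a f ≤ f0 x - amvP g a f0 := by
  set J : StrongDual ℝ E → ℝ := fun f => f x - amvP g a f with hJ
  have hJle : ∀ f, J f ≤ ‖f‖ * ‖x‖ - ‖f‖ ^ 2 := by
    intro f
    have h1 := amvP_ge g a ha f
    have h2 := (le_abs_self _).trans (f.le_opNorm x)
    simp only [hJ]
    linarith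
  have hbdd : BddAbove (Set.range J) := by
    refine ⟨‖x‖ ^ 2, ?_⟩
    rintro _ ⟨f, rfl⟩
    nlinarith [hJle f, sq_nonneg (‖f‖ - ‖x‖), norm_nonneg f, norm_nonneg x]
  set Q := sSup (Set.range J) with hQ
  have hJQ : ∀ f, J f ≤ Q := fun f => le_csSup hbdd ⟨f, rfl⟩
  have hseq : ∀ k : ℕ, ∃ f, Q - 1 / ((k : ℝ) + 1) < J f := by
    intro k
    have : Q - 1 / ((k : ℝ) + 1) < Q := by
      have : (0 : ℝ) < 1 / ((k : ℝ) + 1) := by positivity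
      linarith
    obtain ⟨_, ⟨f, rfl⟩, hf⟩ := exists_lt_of_lt_csSup (Set.range_nonempty J) this
    exact ⟨f, hf⟩
  choose F hF using hseq
  have hFt : Tendsto (fun k => J (F k)) atTop (𝓝 Q) := by
    have h0 : Tendsto (fun k : ℕ => Q - 1 / ((k : ℝ) + 1)) atTop (𝓝 (Q - 0)) :=
      tendsto_one_div_add_atTop_nhds_zero_nat.const_sub Q
    rw [sub_zero] at h0
    exact tendsto_of_tendsto_of_tendsto_of_le_of_le h0 tendsto_const_nhds
      (fun k => (hF k).le) (fun k => hJQ _)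
  let V : Ultrafilter ℕ := Ultrafilter.of atTop
  have hV : (V : Filter ℕ) ≤ atTop := Ultrafilter.of_le atTop
  let U := V.map F
  have hJU : Tendsto J U (𝓝 Q) := hFt.mono_left hV
  have hJ0 : J 0 = 0 := by
    have h1 := amvP_le g a ha (0 : StrongDual ℝ E)
    have h2 := amvP_ge g a ha (0 : StrongDual ℝ E)
    simp only [hJ]
    simp at h1 h2 ⊢
    linarith
  have hQ0 : 0 ≤ Q := hJ0 ▸ hJQ 0
  have hb : ∀ᶠ f in (U : Filter (StrongDual ℝ E)), ‖f‖ ≤ ‖x‖ + 1 := by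
    filter_upwards [hJU.eventually_const_lt (show Q - 1 < Q by linarith)] with f hf
    have := hJle f
    by_contra hcon
    push Not at hcon
    nlinarith [norm_nonneg x, norm_nonneg f]
  obtain ⟨f0, hf0⟩ := amv_weakstar U _ hb
  refine ⟨f0, fun f => ?_⟩
  have h1 : Tendsto (amvP g a) U (𝓝 (f0 x - Q)) := by
    have : amvP g a = fun f => f x - J f := by
      funext f; simp [hJ]
    rw [this]
    exact (hf0 x).sub hJU
  have h2 := amvP_lsc g a ha U f0 _ _ hb hf0 h1
  have h3 := hJQ f
  simp only [hJ] at h3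
  linarith

lemma amv_max_conv (g : ℕ → StrongDual ℝ E) (hg : DenseRange g) (a : ℕ → E)
    (ha : ∀ n, ‖a n‖ ≤ 1)
    (ha2 : ∀ f : StrongDual ℝ E, (∀ n, f (a n) = 0) → f = 0) (x : E)
    (f0 : StrongDual ℝ E) (h0 : ∀ f : StrongDual ℝ E, f x - amvP g a f ≤ f0 x - amvP g a f0)
    (U : Ultrafilter (StrongDual ℝ E)) (R : ℝ)
    (hb : ∀ᶠ f in (U : Filter (StrongDual ℝ E)), ‖f‖ ≤ R)
    (hU : Tendsto (fun f : StrongDual ℝ E => f x - amvP g a f) U (𝓝 (f0 x - amvP g a f0))) :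
    (U : Filter (StrongDual ℝ E)) ≤ 𝓝 f0 := by
  have hgap : ∀ f n, (1 / 2) ^ n * ((amvS g n f - amvS g n f0) ^ 2 / 4 +
      (f (a n) - f0 (a n)) ^ 2 / 4) ≤ ((f0 x - amvP g a f0) - (f x - amvP g a f)) / 2 := by
    intro f n
    have h1 := amvP_gap g a ha f f0 n
    have h2 := h0 ((1 / 2 : ℝ) • (f + f0))
    simp only [smul_apply, add_apply, smul_eq_mul] at h2
    linarith
  obtain ⟨f1, hf1⟩ := amv_weakstar U R hb
  have hlim : Tendsto (fun f : StrongDual ℝ E =>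
      ((f0 x - amvP g a f0) - (f x - amvP g a f)) / 2) U (𝓝 0) := by
    have := (hU.const_sub (f0 x - amvP g a f0)).div_const 2
    simpa using this
  have h1 : Tendsto (amvP g a) U (𝓝 (f1 x - (f0 x - amvP g a f0))) := by
    have : amvP g a = fun f => f x - (f x - amvP g a f) := by
      funext f; simp
    rw [this]
    exact (hf1 x).sub (by simpa using hU)
  have h2 := amvP_lsc g a ha U f1 _ _ hb hf1 h1
  have h10 : f1 - f0 = 0 := by
    apply ha2
    intro n
    have h3 := hgap f1 n
    have h4 : (1 / 2 : ℝ) ^ n * ((amvS g n f1 - amvS g n f0) ^ 2 / 4 +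
      (f1 (a n) - f0 (a n)) ^ 2 / 4) ≤ 0 := by linarith
    have hw : (0 : ℝ) < (1 / 2) ^ n := by positivity
    have h5 := nonpos_of_mul_nonpos_right h4 hw
    have h6 : (f1 (a n) - f0 (a n)) ^ 2 ≤ 0 := by nlinarith [sq_nonneg (amvS g n f1 - amvS g n f0)]
    have h7 := pow_eq_zero_iff (two_ne_zero) |>.1 (le_antisymm h6 (sq_nonneg _))
    simpa using h7
  have h11 : f1 = f0 := sub_eq_zero.1 h10
  subst h11
  refine amv_tight g hg U f1 R hb hf1 fun n => ?_
  have hw : (0 : ℝ) < (1 / 2) ^ n := by positivity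
  have hsq : Tendsto (fun f => (amvS g n f - amvS g n f1) ^ 2) U (𝓝 0) := by
    have hl2 := hlim.const_mul (4 / (1 / 2 : ℝ) ^ n)
    rw [mul_zero] at hl2
    refine squeeze_zero (fun f => sq_nonneg _) (fun f => ?_) hl2
    rw [div_mul_eq_mul_div, le_div_iff₀ hw]
    nlinarith [hgap f n, mul_nonneg hw.le (sq_nonneg (f (a n) - f1 (a n)))]
  rw [tendsto_iff_norm_sub_tendsto_zero]
  have h3 := hsq.sqrt
  simp only [Real.sqrt_sq_eq_abs, Real.sqrt_zero] at h3
  exact h3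

lemma amv_smooth [TopologicalSpace.SeparableSpace E]
    [TopologicalSpace.SeparableSpace (StrongDual ℝ E)] :
    ∃ (q : E → ℝ) (q' : E → StrongDual ℝ E), (∀ x, HasFDerivAt q (q' x) x) ∧
      (∀ x, ‖q' x‖ ≤ ‖x‖) ∧ (∀ x, ‖x‖ ^ 2 / 16 ≤ q x) ∧ (∀ x, q x ≤ ‖x‖ ^ 2) ∧
      (∀ x, q x ≤ q' x x) := by
  set g := TopologicalSpace.denseSeq (StrongDual ℝ E)
  have hg : DenseRange g := TopologicalSpace.denseRange_denseSeq _
  set d := TopologicalSpace.denseSeq E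
  have hd : DenseRange d := TopologicalSpace.denseRange_denseSeq _
  set a : ℕ → E := fun n => (1 + ‖d n‖)⁻¹ • d n with ha_def
  have ha : ∀ n, ‖a n‖ ≤ 1 := by
    intro n
    simp only [ha_def]
    rw [norm_smul, norm_inv, Real.norm_of_nonneg (by positivity), inv_mul_le_iff₀ (by positivity)]
    linarith
  have ha2 : ∀ f : StrongDual ℝ E, (∀ n, f (a n) = 0) → f = 0 := by
    intro f hf
    have : (f : E → ℝ) = (0 : StrongDual ℝ E) := by
      refine hd.equalizer f.continuous continuous_const (funext fun n => ?_)
      have := hf n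
      simp only [ha_def, map_smul, smul_eq_mul, mul_eq_zero, inv_eq_zero] at this
      rcases this with h | h
      · have := norm_nonneg (d n); linarith
      · simpa using h
    exact DFunLike.coe_injective this
  choose F hF using fun x => amv_max_exists g a ha x
  set P := amvP g a with hP
  have hP0 : P 0 = 0 := by
    have h1 := amvP_le g a ha (0 : StrongDual ℝ E)
    have h2 := amvP_ge g a ha (0 : StrongDual ℝ E)
    simp at h1 h2
    exact le_antisymm h1 h2
  have hq0 : ∀ x, 0 ≤ F x x - P (F x) := by
    intro x
    have := hF x 0
    simpa [hP0] using this
  have hFn : ∀ x, ‖F x‖ ≤ ‖x‖ := by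
    intro x
    have h1 := amvP_ge g a ha (F x)
    have h2 := hq0 x
    have h3 := (le_abs_self _).trans ((F x).le_opNorm x)
    by_contra hcon
    push Not at hcon
    nlinarith [norm_nonneg x, norm_nonneg (F x)]
  refine ⟨fun x => F x x - P (F x), F, ?_, hFn, ?_, ?_, ?_⟩
  · intro x
    have hcont : Tendsto F (𝓝 x) (𝓝 (F x)) := by
      rw [tendsto_iff_ultrafilter]
      intro V hV
      have hVt : Tendsto (fun y => y) (V : Filter E) (𝓝 x) := hV
      have hbV : ∀ᶠ y in (V : Filter E), ‖F y‖ ≤ ‖x‖ + 1 := by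
        filter_upwards [hVt.norm.eventually_lt_const (show ‖x‖ < ‖x‖ + 1 by linarith)] with y hy
        exact (hFn y).trans hy.le
      refine amv_max_conv g hg a ha ha2 x (F x) (hF x) (V.map F) (‖x‖ + 1) hbV ?_
      change Tendsto (fun y => F y x - P (F y)) V _
      have hyx : Tendsto (fun y => ‖y - x‖) (V : Filter E) (𝓝 0) :=
        tendsto_iff_norm_sub_tendsto_zero.1 hVt
      have hlow : Tendsto (fun y => (F x x - P (F x)) - (2 * ‖x‖ + 1) * ‖y - x‖) V
          (𝓝 (F x x - P (F x))) := by
        have := (hyx.const_mul (2 * ‖x‖ + 1)).const_sub (F x x - P (F x))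
        simpa using this
      refine tendsto_of_tendsto_of_tendsto_of_le_of_le' hlow tendsto_const_nhds ?_
        (Eventually.of_forall fun y => hF x (F y))
      filter_upwards [hbV] with y hy
      have h1 := hF y (F x)
      have h2 : |F x (y - x)| ≤ ‖F x‖ * ‖y - x‖ := (F x).le_opNorm _
      have h3 : |F y (y - x)| ≤ ‖F y‖ * ‖y - x‖ := (F y).le_opNorm _
      have h4 : ‖F x‖ * ‖y - x‖ ≤ ‖x‖ * ‖y - x‖ := by gcongr; exact hFn x
      have h5 : ‖F y‖ * ‖y - x‖ ≤ (‖x‖ + 1) * ‖y - x‖ := by gcongr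
      rw [map_sub] at h2 h3
      have := (abs_le.1 h2).1
      have := (abs_le.1 h3).2
      linarith
    rw [hasFDerivAt_iff_isLittleO, Asymptotics.isLittleO_iff]
    intro c hc
    have hc2 := Metric.tendsto_nhds.1 hcont c hc
    filter_upwards [hc2] with y hy
    rw [dist_eq_norm] at hy
    have h1 := hF y (F x)
    have h2 := hF x (F y)
    have h3 : |(F y - F x) (y - x)| ≤ ‖F y - F x‖ * ‖y - x‖ := (F y - F x).le_opNorm _
    have h4 : ‖F y - F x‖ * ‖y - x‖ ≤ c * ‖y - x‖ := by gcongr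
    have h5 := (abs_le.1 h3).2
    simp only [sub_apply, map_sub] at h5
    rw [Real.norm_eq_abs, abs_le, map_sub]
    have : 0 ≤ c * ‖y - x‖ := by positivity
    constructor <;> linarith
  · intro x
    obtain ⟨e, he1, he2⟩ := exists_dual_vector'' ℝ x
    have h1 := hF x ((‖x‖ / 8) • e)
    have h2 := amvP_le g a ha ((‖x‖ / 8) • e)
    have h3 : ‖(‖x‖ / 8) • e‖ ≤ ‖x‖ / 8 := by
      rw [norm_smul, Real.norm_of_nonneg (by positivity)]
      exact mul_le_of_le_one_right (by positivity) he1
    have h4 : ‖(‖x‖ / 8) • e‖ ^ 2 ≤ (‖x‖ / 8) ^ 2 := by gcongr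
    simp only [smul_apply, smul_eq_mul, he2] at h1
    simp only [RCLike.ofReal_real_eq_id, id] at h1
    nlinarith
  · intro x
    have h1 := amvP_ge g a ha (F x)
    have h3 := (le_abs_self _).trans ((F x).le_opNorm x)
    have h4 := hFn x
    have : ‖F x‖ * ‖x‖ ≤ ‖x‖ * ‖x‖ := by gcongr
    nlinarith [sq_nonneg ‖F x‖]
  · intro x
    have h1 := amvP_ge g a ha (F x)
    nlinarith [sq_nonneg ‖F x‖]

end AmvSmooth
section AmvVP

variable {E : Type*} [NormedAddCommGroup E] [NormedSpace ℝ E]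

lemma amv_vp_seq (q : E → ℝ) (hq0 : ∀ x, 0 ≤ q x) (S : Set E) (F : E → ℝ) (x0 : E) (hx0 : x0 ∈ S)
    (θ : ℝ) (hθ : 0 < θ) (hmin : ∀ x ∈ S, F x0 ≤ F x + θ ^ 2) :
    ∃ u : ℕ → E, u 0 = x0 ∧ (∀ n, u n ∈ S) ∧ ∀ n, ∀ y ∈ S,
      F (u n) + ∑ i ∈ Finset.range n, (1 / 2) ^ i * q (u n - u i) ≤
      F y + ∑ i ∈ Finset.range n, (1 / 2) ^ i * q (y - u i) + θ ^ 2 * (1 / 8) ^ n := by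
  have hnext : ∀ (A : E → ℝ) (e : ℝ), (∀ x, 0 ≤ A x) → 0 < e →
      ∃ x ∈ S, ∀ y ∈ S, F x + A x ≤ F y + A y + e := by
    intro A e hA he
    have hbdd : BddBelow ((fun x => F x + A x) '' S) := by
      refine ⟨F x0 - θ ^ 2, ?_⟩
      rintro _ ⟨x, hx, rfl⟩
      have := hmin x hx
      have := hA x
      simp only
      linarith
    have hne : ((fun x => F x + A x) '' S).Nonempty := ⟨_, x0, hx0, rfl⟩
    obtain ⟨_, ⟨x, hx, rfl⟩, hlt⟩ := exists_lt_of_csInf_lt hne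
      (show sInf ((fun x => F x + A x) '' S) < sInf ((fun x => F x + A x) '' S) + e by linarith)
    refine ⟨x, hx, fun y hy => ?_⟩
    have := csInf_le hbdd ⟨y, hy, rfl⟩
    simp only at this hlt
    linarith
  choose! nx hnx1 hnx2 using hnext
  let st : ℕ → E × (E → ℝ) := fun n => Nat.rec (x0, fun _ => 0)
    (fun n p => (nx (fun x => p.2 x + (1 / 2) ^ n * q (x - p.1)) (θ ^ 2 * (1 / 8) ^ (n + 1)),
      fun x => p.2 x + (1 / 2) ^ n * q (x - p.1))) n
  have hst2 : ∀ n, (st (n + 1)).2 = fun x => (st n).2 x + (1 / 2) ^ n * q (x - (st n).1) :=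
    fun n => rfl
  have hst1 : ∀ n, (st (n + 1)).1 = nx (st (n + 1)).2 (θ ^ 2 * (1 / 8) ^ (n + 1)) := fun n => rfl
  have hA : ∀ n x, (st n).2 x = ∑ i ∈ Finset.range n, (1 / 2) ^ i * q (x - (st i).1) := by
    intro n
    induction n with
    | zero => intro x; simp [st]
    | succ n ih => intro x; rw [Finset.sum_range_succ, ← ih]
  have hA0 : ∀ n x, 0 ≤ (st n).2 x := by
    intro n x
    rw [hA]
    exact Finset.sum_nonneg fun i _ => mul_nonneg (by positivity) (hq0 _)
  refine ⟨fun n => (st n).1, rfl, fun n => ?_, fun n y hy => ?_⟩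
  · cases n with
    | zero => exact hx0
    | succ n => simp only [hst1]; exact hnx1 _ _ (hA0 (n + 1)) (by positivity)
  · rw [← hA, ← hA]
    cases n with
    | zero =>
      have := hmin y hy
      simpa [st] using this
    | succ n =>
      have := hnx2 (st (n + 1)).2 (θ ^ 2 * (1 / 8) ^ (n + 1)) (hA0 (n + 1)) (by positivity) y hy
      rw [← hst1] at this
      exact this

lemma amv_vp [CompleteSpace E] (q : E → ℝ) (q' : E → StrongDual ℝ E)
    (hd : ∀ x, HasFDerivAt q (q' x) x)
    (hq' : ∀ x, ‖q' x‖ ≤ ‖x‖) (hlow : ∀ x, ‖x‖ ^ 2 / 16 ≤ q x) (hup : ∀ x, q x ≤ ‖x‖ ^ 2)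
    (S : Set E) (F : E → ℝ)
    (hepi : ∀ (u : ℕ → E) (x : E) (r : ℕ → ℝ) (L : ℝ), (∀ n, u n ∈ S) →
      Tendsto u atTop (𝓝 x) → (∀ n, F (u n) ≤ r n) → Tendsto r atTop (𝓝 L) → x ∈ S ∧ F x ≤ L)
    (x0 : E) (hx0 : x0 ∈ S)
    (θ : ℝ) (hθ : 0 < θ) (hmin : ∀ x ∈ S, F x0 ≤ F x + θ ^ 2) :
    ∃ x ∈ S, ∃ l : StrongDual ℝ E, ‖x - x0‖ ≤ 12 * θ ∧ F x ≤ F x0 + 1152 * θ ^ 2 ∧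
      ‖l‖ ≤ 24 * θ ∧
      ∀ ε : ℝ, 0 < ε → ∀ᶠ y in 𝓝 x, y ∈ S → F x + l (y - x) - ε * ‖y - x‖ ≤ F y := by
  have hq0 : ∀ x, 0 ≤ q x := fun x => le_trans (by positivity) (hlow x)
  have hqc : Continuous q := continuous_iff_continuousAt.2 fun x => (hd x).continuousAt
  have hqz : q 0 = 0 := le_antisymm (by simpa using hup 0) (hq0 0)
  obtain ⟨u, hu0, huS, hu⟩ := amv_vp_seq q hq0 S F x0 hx0 θ hθ hmin
  have hstep : ∀ n, dist (u n) (u (n + 1)) ≤ 12 * θ / 2 / 2 ^ n := by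
    intro n
    have h1 := hu n (u (n + 1)) (huS _)
    have h2 := hu (n + 1) (u n) (huS n)
    rw [Finset.sum_range_succ, Finset.sum_range_succ, sub_self, hqz] at h2
    have h3 : (1 / 2) ^ n * q (u (n + 1) - u n) ≤
        θ ^ 2 * (1 / 8) ^ n + θ ^ 2 * (1 / 8) ^ (n + 1) := by linarith
    have h4 := hlow (u (n + 1) - u n)
    set t : ℝ := (1 / 2) ^ n with ht
    have htp : 0 < t := by positivity
    have h8 : (1 / 8 : ℝ) ^ n = t * t ^ 2 := by
      rw [ht, ← pow_mul, ← pow_add, show n + n * 2 = 3 * n by ring, pow_mul]; norm_num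
    rw [pow_succ (1 / 8 : ℝ) n, h8] at h3
    have h5 : q (u (n + 1) - u n) ≤ θ ^ 2 * t ^ 2 * (9 / 8) := by
      refine le_of_mul_le_mul_left ?_ htp
      linarith
    rw [dist_comm, dist_eq_norm]
    have h6 : 12 * θ / 2 / 2 ^ n = 6 * θ * t := by
      rw [ht, one_div, inv_pow]; ring
    rw [h6]
    refine abs_le_of_sq_le_sq' ?_ (by positivity) |>.2
    nlinarith [sq_nonneg (θ * t)]
  obtain ⟨x, hx⟩ := cauchySeq_tendsto_of_complete (cauchySeq_of_le_geometric_two hstep)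
  have hdist : ∀ n, ‖x - u n‖ ≤ 12 * θ := by
    intro n
    have h := dist_le_of_le_geometric_two_of_tendsto hstep hx n
    rw [dist_comm, dist_eq_norm] at h
    refine h.trans (div_le_self (by positivity) (one_le_pow₀ (by norm_num)))
  have hsum : ∀ y, Summable fun i => (1 / 2 : ℝ) ^ i * q (y - u i) := by
    intro y
    refine Summable.of_nonneg_of_le (fun i => mul_nonneg (by positivity) (hq0 _)) (fun i => ?_)
      (summable_geometric_two.mul_right ((‖y - x‖ + 12 * θ) ^ 2))
    gcongr
    refine (hup _).trans ?_
    gcongr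
    have : y - u i = (y - x) + (x - u i) := by abel
    rw [this]
    exact (norm_add_le _ _).trans (by gcongr; exact hdist i)
  set A : E → ℝ := fun y => ∑' i, (1 / 2 : ℝ) ^ i * q (y - u i) with hA
  have hAle : ∀ n y, ∑ i ∈ Finset.range n, (1 / 2) ^ i * q (y - u i) ≤ A y := fun n y =>
    (hsum y).sum_le_tsum _ (fun i _ => mul_nonneg (by positivity) (hq0 _))
  have h8 : Tendsto (fun n : ℕ => θ ^ 2 * (1 / 8 : ℝ) ^ n) atTop (𝓝 0) := by
    have := (tendsto_pow_atTop_nhds_zero_of_lt_one (r := (1 / 8 : ℝ)) (by norm_num)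
      (by norm_num)).const_mul (θ ^ 2)
    simpa using this
  have hN : ∀ y ∈ S, ∀ N, x ∈ S ∧
      F x ≤ F y + A y + 0 - ∑ i ∈ Finset.range N, (1 / 2) ^ i * q (x - u i) := by
    intro y hy N
    have hc : Continuous fun z => ∑ i ∈ Finset.range N, (1 / 2 : ℝ) ^ i * q (z - u i) := by
      fun_prop
    refine hepi (fun n => u (n + N)) x (fun n => F y + A y + θ ^ 2 * (1 / 8) ^ (n + N) -
      ∑ i ∈ Finset.range N, (1 / 2) ^ i * q (u (n + N) - u i)) _ (fun n => huS _)
      (hx.comp (tendsto_add_atTop_nat N)) (fun n => ?_) ?_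
    · have h1 := hu (n + N) y hy
      have h2 := hAle (n + N) y
      have h3 : ∑ i ∈ Finset.range N, (1 / 2 : ℝ) ^ i * q (u (n + N) - u i) ≤
          ∑ i ∈ Finset.range (n + N), (1 / 2 : ℝ) ^ i * q (u (n + N) - u i) :=
        Finset.sum_le_sum_of_subset_of_nonneg
          (Finset.range_subset_range.2 (Nat.le_add_left N n))
          (fun i _ _ => mul_nonneg (by positivity) (hq0 _))
      linarith
    · exact ((h8.comp (tendsto_add_atTop_nat N)).const_add _).sub
        ((hc.tendsto x).comp (hx.comp (tendsto_add_atTop_nat N)))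
  have hxS : x ∈ S := (hN x0 hx0 0).1
  have hmin' : ∀ y ∈ S, F x + A x ≤ F y + A y := by
    intro y hy
    have := le_of_tendsto' (hsum x).hasSum.tendsto_sum_nat
      (fun N => show _ ≤ F y + A y - F x by linarith [(hN y hy N).2])
    have h2 : A x ≤ F y + A y - F x := this
    linarith
  have hAd : HasFDerivAt A (∑' i, (1 / 2 : ℝ) ^ i • q' (x - u i)) x := by
    refine hasFDerivAt_tsum_of_isPreconnected (u := fun i => (1 / 2 : ℝ) ^ i * (1 + 12 * θ))
      (f' := fun i y => (1 / 2 : ℝ) ^ i • q' (y - u i))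
      (s := Metric.ball x 1) (x₀ := x)
      (summable_geometric_two.mul_right _) Metric.isOpen_ball
      (convex_ball x 1).isPreconnected (fun n y _ => ?_) (fun n y hy => ?_)
      (Metric.mem_ball_self one_pos) (hsum x) (Metric.mem_ball_self one_pos)
    · have := (hd (y - u n)).comp y ((hasFDerivAt_id y).sub_const (u n))
      simpa using this.const_mul ((1 / 2 : ℝ) ^ n)
    · rw [norm_smul, Real.norm_of_nonneg (by positivity)]
      gcongr
      refine (hq' _).trans ?_
      rw [Metric.mem_ball, dist_eq_norm] at hy
      have : y - u n = (y - x) + (x - u n) := by abel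
      rw [this]
      exact (norm_add_le _ _).trans (add_le_add hy.le (hdist n))
  have hu0' : ‖x - x0‖ ≤ 12 * θ := hu0 ▸ hdist 0
  refine ⟨x, hxS, -(∑' i, (1 / 2 : ℝ) ^ i • q' (x - u i)), hu0', ?_, ?_, ?_⟩
  · have h1 := hmin' x0 hx0
    have h2 : 0 ≤ A x := tsum_nonneg fun i => mul_nonneg (by positivity) (hq0 _)
    have h3 : A x0 ≤ 1152 * θ ^ 2 := by
      have h := (hsum x0).tsum_le_tsum (g := fun i => (1 / 2 : ℝ) ^ i * (24 * θ) ^ 2) (fun i => ?_)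
        (summable_geometric_two.mul_right _)
      · rw [tsum_mul_right, tsum_geometric_two] at h
        have h' : A x0 ≤ 2 * (24 * θ) ^ 2 := h
        linarith
      · gcongr
        refine (hup _).trans ?_
        gcongr
        have : x0 - u i = (x - u i) - (x - x0) := by abel
        rw [this]
        refine (norm_sub_le _ _).trans ?_
        linarith [hdist i]
    linarith
  · rw [norm_neg]
    have h := tsum_of_norm_bounded (f := fun i => (1 / 2 : ℝ) ^ i • q' (x - u i))
      (g := fun i => (1 / 2 : ℝ) ^ i * (12 * θ)) (hasSum_geometric_two.mul_right (12 * θ))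
      (fun i => by
        rw [norm_smul, Real.norm_of_nonneg (by positivity)]
        gcongr
        exact (hq' _).trans (hdist i))
    linarith
  · intro ε hε
    rw [hasFDerivAt_iff_isLittleO, Asymptotics.isLittleO_iff] at hAd
    filter_upwards [hAd hε] with y hy hyS
    have h1 := hmin' y hyS
    have h2 := (abs_le.1 hy).2
    simp only [neg_apply]
    linarith

end AmvVP
section AmvSep

variable {E : Type*} [NormedAddCommGroup E] [NormedSpace ℝ E]

lemma amv_exists_theta (k1 k2 k3 k4 k5 B1 B2 B3 B4 B5 : ℝ) (h1 : 0 < B1) (h2 : 0 < B2)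
    (h3 : 0 < B3) (h4 : 0 < B4) (h5 : 0 < B5) :
    ∃ θ : ℝ, 0 < θ ∧ θ < 1 ∧ k1 * θ < B1 ∧ k2 * θ < B2 ∧ k3 * θ < B3 ∧ k4 * θ < B4 ∧
      k5 * θ < B5 := by
  have key : ∀ k B : ℝ, 0 < B → ∀ᶠ θ in 𝓝[>] (0 : ℝ), k * θ < B := by
    intro k B hB
    have : Tendsto (fun θ : ℝ => k * θ) (𝓝[>] 0) (𝓝 (k * 0)) :=
      ((continuous_const.mul continuous_id).tendsto (0 : ℝ)).mono_left nhdsWithin_le_nhds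
    rw [mul_zero] at this
    exact this.eventually_lt_const hB
  have h0 : ∀ᶠ θ in 𝓝[>] (0 : ℝ), 0 < θ := self_mem_nhdsWithin
  obtain ⟨θ, a0, a1, a2, a3, a4, a5, a6⟩ := (h0.and ((key 1 1 one_pos).and ((key k1 B1 h1).and
    ((key k2 B2 h2).and ((key k3 B3 h3).and ((key k4 B4 h4).and (key k5 B5 h5))))))).exists
  exact ⟨θ, a0, by linarith, a2, a3, a4, a5, a6⟩

set_option maxHeartbeats 1000000 in
lemma amv_sep [CompleteSpace E] [TopologicalSpace.SeparableSpace E]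
    [TopologicalSpace.SeparableSpace (StrongDual ℝ E)] (φ : E → EReal) (hnobot : ∀ x, φ x ≠ ⊥)
    (hlsc : LowerSemicontinuous φ) (a b : E) (hab : a ≠ b) (tc : ℝ) (htc0 : 0 ≤ tc) (htc1 : tc < 1)
    (c : E) (hcdef : c = a + tc • (b - a)) (m : ℝ) (hc : φ c = m)
    (hseg : ∀ s ∈ Set.Icc (0 : ℝ) 1, (m : EReal) ≤ φ (a + s • (b - a))) (ε : ℝ) (hε : 0 < ε) :
    ∃ x, ∃ u ∈ FrechetSubdiff φ x, ∃ v : ℝ, φ x = v ∧ |v - m| < ε ∧ ‖x - c‖ < ε ∧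
      -ε < u (b - a) ∧ -ε < u (b - x) ∧ (0 < tc → |u (b - a)| < ε) := by
  obtain ⟨q, q', hd, hq', hlow, hup, hqq⟩ := amv_smooth (E := E)
  have hq0 : ∀ x, 0 ≤ q x := fun x => le_trans (by positivity) (hlow x)
  have hqc : Continuous q := continuous_iff_continuousAt.2 fun x => (hd x).continuousAt
  have hqz : q 0 = 0 := le_antisymm (by simpa using hup 0) (hq0 0)
  set w := b - a with hw
  have hwpos : 0 < ‖w‖ := norm_pos_iff.2 (sub_ne_zero.2 hab.symm)
  have hreal : ∀ x, φ x ≠ ⊤ → φ x = ((φ x).toReal : EReal) := fun x hx =>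
    (EReal.coe_toReal hx (hnobot x)).symm
  -- the neighbourhood of c
  have hopen : ∀ r : ℝ, IsOpen {x | (r : EReal) < φ x} := fun r => hlsc.isOpen_preimage r
  obtain ⟨δ0, hδ0, hball⟩ := Metric.isOpen_iff.1 (hopen (m - ε / 2)) c (by
    simp only [Set.mem_ofPred_eq, hc, EReal.coe_lt_coe_iff]; linarith)
  set δ := δ0 / 2 with hδ
  have hδpos : 0 < δ := by positivity
  obtain ⟨θ, hθ, hθ1, k1, k2, k3, k4, k5⟩ := amv_exists_theta 12 1152
    (24 * (‖w‖ + ‖b - c‖ + 12)) 60 60 (min δ ε) ε ε ((1 - tc) * ‖w‖)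
    (if 0 < tc then tc * ‖w‖ else 1) (lt_min hδpos hε) hε hε
    (mul_pos (by linarith) hwpos) (by split_ifs <;> positivity)
  have hKc : IsCompact ((fun s : ℝ => a + s • w) '' Set.Icc (0 : ℝ) 1) :=
    isCompact_Icc.image (by fun_prop)
  obtain ⟨r, hr, hthick⟩ := hKc.exists_thickening_subset_open (hopen (m - θ ^ 2)) (by
    rintro _ ⟨s, hs, rfl⟩
    refine lt_of_lt_of_le ?_ (hseg s hs)
    rw [EReal.coe_lt_coe_iff]
    have : 0 < θ ^ 2 := by positivity
    linarith)
  set t := 16 * ε / r ^ 2 with ht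
  have htpos : 0 < t := by positivity
  set D : E → ℝ := fun x => sInf ((fun s : ℝ => q (x - (a + s • w))) '' Set.Icc (0 : ℝ) 1) with hD
  have hDc : Continuous D := isCompact_Icc.continuous_sInf (f := fun x (s : ℝ) => q (x - (a + s • w)))
    (by fun_prop)
  have hDle : ∀ x, ∀ s ∈ Set.Icc (0 : ℝ) 1, D x ≤ q (x - (a + s • w)) := by
    intro x s hs
    refine csInf_le ⟨0, ?_⟩ ⟨s, hs, rfl⟩
    rintro _ ⟨s', -, rfl⟩
    exact hq0 _
  have hDatt : ∀ x, ∃ s ∈ Set.Icc (0 : ℝ) 1, D x = q (x - (a + s • w)) := by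
    intro x
    exact isCompact_Icc.exists_sInf_image_eq ⟨0, by simp⟩ (by fun_prop)
  have hD0 : ∀ x, 0 ≤ D x := by
    intro x
    obtain ⟨s, -, h⟩ := hDatt x
    rw [h]; exact hq0 _
  have hDcz : D c = 0 := by
    refine le_antisymm ?_ (hD0 c)
    have := hDle c tc ⟨htc0, htc1.le⟩
    rwa [← hcdef, sub_self, hqz] at this
  set S : Set E := {x | dist x c ≤ δ ∧ φ x ≠ ⊤} with hS
  set F : E → ℝ := fun x => (φ x).toReal + t * D x with hF
  have hcS : c ∈ S := ⟨by simpa using hδpos.le, by rw [hc]; exact EReal.coe_ne_top m⟩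
  have hFc : F c = m := by simp [hF, hDcz, hc]
  have hlowS : ∀ x ∈ S, m - ε / 2 < (φ x).toReal := by
    intro x hx
    have h1 : x ∈ Metric.ball c δ0 := by
      rw [Metric.mem_ball]; have := hx.1; linarith
    have h2 : ((m - ε / 2 : ℝ) : EReal) < φ x := hball h1
    rw [hreal x hx.2, EReal.coe_lt_coe_iff] at h2
    exact h2
  obtain ⟨x, hxS, l, hx1, hx2, hl, hx3⟩ := amv_vp q q' hd hq' hlow hup S F (by
    intro u x r' L huS hux hur hrL
    have h1 : IsClosed {p : E × EReal | φ p.1 ≤ p.2} := hlsc.isClosed_epigraph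
    have h2 : Tendsto (fun n => (u n, ((r' n - t * D (u n) : ℝ) : EReal))) atTop
        (𝓝 (x, ((L - t * D x : ℝ) : EReal))) := by
      refine hux.prodMk_nhds ?_
      refine (continuous_coe_real_ereal.tendsto _).comp ?_
      exact hrL.sub (((hDc.tendsto x).comp hux).const_mul t)
    have h3 : φ x ≤ ((L - t * D x : ℝ) : EReal) := by
      refine h1.mem_of_tendsto h2 (Eventually.of_forall fun n => ?_)
      have := hur n
      simp only [hF] at this
      simp only [Set.mem_ofPred_eq]
      rw [hreal _ (huS n).2, EReal.coe_le_coe_iff]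
      linarith
    have h4 : φ x ≠ ⊤ := ne_top_of_le_ne_top (EReal.coe_ne_top _) h3
    refine ⟨⟨?_, h4⟩, ?_⟩
    · exact le_of_tendsto (hux.dist tendsto_const_nhds) (Eventually.of_forall fun n => (huS n).1)
    · rw [hreal _ h4, EReal.coe_le_coe_iff] at h3
      simp only [hF]
      linarith) c hcS θ hθ (by
    intro x hx
    rw [hFc]
    simp only [hF]
    by_cases hth : x ∈ Metric.thickening r ((fun s : ℝ => a + s • w) '' Set.Icc (0 : ℝ) 1)
    · have h2 : ((m - θ ^ 2 : ℝ) : EReal) < φ x := hthick hth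
      rw [hreal x hx.2, EReal.coe_lt_coe_iff] at h2
      have := mul_nonneg htpos.le (hD0 x)
      linarith
    · obtain ⟨s, hs, h⟩ := hDatt x
      have h1 : r ≤ ‖x - (a + s • w)‖ := by
        by_contra hcon
        push Not at hcon
        exact hth (Metric.mem_thickening_iff.2 ⟨_, ⟨s, hs, rfl⟩, by rwa [dist_eq_norm]⟩)
      have h2 := hlow (x - (a + s • w))
      rw [← h] at h2
      have h3 : r ^ 2 / 16 ≤ D x := le_trans (by gcongr) h2
      have h4 : ε ≤ t * D x := by
        calc ε = t * (r ^ 2 / 16) := by rw [ht]; field_simp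
          _ ≤ _ := by gcongr
      have := hlowS x hx
      have : 0 ≤ θ ^ 2 := sq_nonneg _
      linarith)
  obtain ⟨s, hs, hDs⟩ := hDatt x
  set p := a + s • w with hp
  set g := q' (x - p) with hg
  have hxp : ‖x - p‖ ≤ 4 * ‖x - c‖ := by
    have h1 := hlow (x - p)
    have h2 := hDle x tc ⟨htc0, htc1.le⟩
    rw [← hcdef, hDs] at h2
    have h3 := hup (x - c)
    refine abs_le_of_sq_le_sq' ?_ (by positivity) |>.2
    nlinarith
  have hpc : |s - tc| * ‖w‖ ≤ 60 * θ := by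
    have h1 : p - c = (s - tc) • w := by rw [hp, hcdef, sub_smul]; abel
    have h2 : ‖p - c‖ = |s - tc| * ‖w‖ := by rw [h1, norm_smul, Real.norm_eq_abs]
    rw [← h2]
    have h3 : p - c = (x - c) - (x - p) := by abel
    rw [h3]
    have := norm_sub_le (x - c) (x - p)
    linarith
  have hs1 : s < 1 := by
    have h1 : |s - tc| < 1 - tc := lt_of_mul_lt_mul_right (hpc.trans_lt k4) hwpos.le
    have := (abs_lt.1 h1).2
    linarith
  have hs0 : 0 < tc → 0 < s := by
    intro h
    rw [if_pos h] at k5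
    have h1 : |s - tc| < tc := lt_of_mul_lt_mul_right (hpc.trans_lt k5) hwpos.le
    have := (abs_lt.1 h1).1
    linarith
  -- the sign of the derivative in the direction of the segment
  have hder : HasDerivAt (fun σ : ℝ => q (x - (a + σ • w))) (-(g w)) s := by
    have h1 : HasDerivAt (fun σ : ℝ => x - (a + σ • w)) (-w) s := by
      have := (((hasDerivAt_id s).smul_const w).const_add a).const_sub x
      simpa using this
    have h2 := (hd (x - p)).comp_hasDerivAt s h1
    rw [map_neg] at h2
    exact h2
  have hminon : IsLocalMinOn (fun σ : ℝ => q (x - (a + σ • w))) (Set.Icc 0 1) s := by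
    refine IsMinOn.localize fun σ hσ => ?_
    have := hDle x σ hσ
    rw [hDs] at this
    exact this
  have hgw1 : 0 ≤ -(g w) := by
    have h := hminon.hasFDerivWithinAt_nonneg hder.hasFDerivAt.hasFDerivWithinAt
      (sub_mem_posTangentConeAt_of_segment_subset (y := 1)
        ((convex_Icc (0 : ℝ) 1).segment_subset hs (by simp)))
    simp at h
    have h' : 0 ≤ (1 - s) * (-(g w)) := by linarith
    exact nonneg_of_mul_nonneg_right h' (by linarith)
  have hgw2 : 0 < tc → g w = 0 := by
    intro h0
    have h := hminon.hasFDerivWithinAt_nonneg hder.hasFDerivAt.hasFDerivWithinAt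
      (sub_mem_posTangentConeAt_of_segment_subset (y := 0)
        ((convex_Icc (0 : ℝ) 1).segment_subset hs (by simp)))
    simp at h
    have h' : 0 ≤ s * (g w) := by linarith
    have := nonneg_of_mul_nonneg_right h' (hs0 h0)
    linarith
  have hlw : |l w| ≤ 24 * θ * ‖w‖ := (l.le_opNorm w).trans (by gcongr)
  have hk3' : 24 * θ * ‖w‖ < ε := by
    nlinarith [norm_nonneg (b - c), mul_nonneg hθ.le (norm_nonneg (b - c))]
  have hxc12 : ‖x - c‖ < min δ ε := lt_of_le_of_lt hx1 k1
  have hφx := hreal x hxS.2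
  refine ⟨x, l - t • g, ⟨hxS.2, ?_⟩, (φ x).toReal, hφx, ?_, hxc12.trans_le (min_le_right _ _),
    ?_, ?_, ?_⟩
  · intro ε' hε'
    have e1 := hx3 (ε' / 2) (by positivity)
    have e2 : ∀ᶠ y in 𝓝 x, q (y - p) - q (x - p) - g (y - x) ≤ ε' / (2 * t) * ‖y - x‖ := by
      have hcomp : HasFDerivAt (fun y => q (y - p)) g x := by
        have := (hd (x - p)).comp x ((hasFDerivAt_id x).sub_const p)
        rw [ContinuousLinearMap.comp_id] at this
        exact this
      rw [hasFDerivAt_iff_isLittleO, Asymptotics.isLittleO_iff] at hcomp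
      filter_upwards [hcomp (show 0 < ε' / (2 * t) by positivity)] with y hy
      exact (abs_le.1 hy).2
    have e3 : ∀ᶠ y in 𝓝 x, dist y c < δ := by
      have : Tendsto (fun y => dist y c) (𝓝 x) (𝓝 (dist x c)) :=
        (continuous_id.dist continuous_const).tendsto x
      refine this.eventually_lt_const ?_
      rw [dist_eq_norm]
      exact hxc12.trans_le (min_le_left _ _)
    filter_upwards [e1, e2, e3] with y y1 y2 y3
    by_cases hy : φ y = ⊤
    · rw [hy]; exact le_top
    have y1' := y1 ⟨y3.le, hy⟩
    simp only [hF] at y1'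
    have h1 := hDle y s hs
    rw [← hp] at h1
    rw [hDs] at y1'
    rw [hφx, hreal y hy, ← EReal.coe_add, ← EReal.coe_sub, EReal.coe_le_coe_iff]
    simp only [sub_apply, smul_apply, smul_eq_mul]
    have h2 : t * D y ≤ t * q (y - p) := by gcongr
    have h3 : t * (q (y - p) - q (x - p) - g (y - x)) ≤ ε' / 2 * ‖y - x‖ := by
      calc _ ≤ t * (ε' / (2 * t) * ‖y - x‖) := by gcongr
        _ = _ := by field_simp
    linarith
  · have h1 := hlowS x hxS
    have h2 : (φ x).toReal ≤ F x := by
      simp only [hF]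
      have := mul_nonneg htpos.le (hD0 x)
      linarith
    rw [hFc] at hx2
    rw [abs_lt]
    have : 1152 * θ ^ 2 ≤ 1152 * θ := by nlinarith
    constructor <;> linarith
  · simp only [sub_apply, smul_apply, smul_eq_mul]
    have := (abs_le.1 hlw).1
    have := mul_nonneg htpos.le hgw1
    linarith
  · have h1 : b - x = (1 - s) • w - (x - p) := by rw [hp, sub_smul, hw, one_smul]; abel
    have h2 : g (b - x) ≤ 0 := by
      rw [h1, map_sub, map_smul, smul_eq_mul]
      have h3 := hqq (x - p)
      have h4 := hq0 (x - p)
      have h5 := mul_nonneg (show 0 ≤ 1 - s by linarith) hgw1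
      have h6 : q (x - p) ≤ g (x - p) := h3
      linarith
    have h7 : |l (b - x)| ≤ 24 * θ * ‖b - x‖ := (l.le_opNorm _).trans (by gcongr)
    have h8 : ‖b - x‖ ≤ ‖b - c‖ + 12 := by
      have : b - x = (b - c) - (x - c) := by abel
      rw [this]
      have := norm_sub_le (b - c) (x - c)
      linarith
    have h9 : 24 * θ * ‖b - x‖ ≤ 24 * θ * (‖b - c‖ + 12) := by gcongr
    have h10 := (abs_le.1 h7).1
    have h11 : t * g (b - x) ≤ 0 := mul_nonpos_of_nonneg_of_nonpos htpos.le h2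
    simp only [sub_apply, smul_apply, smul_eq_mul]
    nlinarith [mul_nonneg hθ.le (norm_nonneg w)]
  · intro h0
    simp only [sub_apply, smul_apply, smul_eq_mul, hgw2 h0, mul_zero, sub_zero]
    exact lt_of_le_of_lt hlw hk3'

end AmvSep
section AmvRed

open scoped NNReal

variable {X : Type*} [NormedAddCommGroup X] [NormedSpace ℝ X]

lemma amv_hb (A : Set (X × ℝ)) (K : ℝ) (hK : 0 ≤ K)
    (h : ∀ p ∈ Submodule.span ℝ≥0 A, 0 ≤ p.2 + K * ‖p.1‖) :
    ∃ xs : X →L[ℝ] ℝ, ∀ p ∈ A, xs p.1 ≤ p.2 := by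
  set T : Set (X × ℝ) := (Submodule.span ℝ≥0 A : Set (X × ℝ)) with hT
  have hsm : ∀ (r : ℝ), 0 ≤ r → ∀ p ∈ T, r • p ∈ T := by
    intro r hr p hp
    exact Submodule.smul_mem (Submodule.span ℝ≥0 A) (⟨r, hr⟩ : ℝ≥0) hp
  have hTc : Convex ℝ T := by
    intro p hp p' hp' r r' hr hr' _
    exact Submodule.add_mem _ (hsm r hr p hp) (hsm r' hr' p' hp')
  have hOc : Convex ℝ {p : X × ℝ | p.2 + K * ‖p.1‖ < 0} := by
    intro p hp p' hp' r r' hr hr' hrr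
    simp only [Set.mem_ofPred_eq] at hp hp' ⊢
    have h1 : ‖(r • p + r' • p').1‖ ≤ r * ‖p.1‖ + r' * ‖p'.1‖ := by
      refine (norm_add_le _ _).trans ?_
      simp [norm_smul, abs_of_nonneg hr, abs_of_nonneg hr']
    have h2 : (r • p + r' • p').2 = r * p.2 + r' * p'.2 := by simp
    rw [h2]
    have h3 := mul_le_mul_of_nonneg_left h1 hK
    have h4 : r * (p.2 + K * ‖p.1‖) + r' * (p'.2 + K * ‖p'.1‖) < 0 := by
      rcases hr.eq_or_lt with h0 | h0
      · subst h0
        have : r' = 1 := by linarith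
        subst this; linarith
      · have := mul_neg_of_pos_of_neg h0 hp
        have := mul_nonpos_of_nonneg_of_nonpos hr' hp'.le
        linarith
    linarith
  have hOo : IsOpen {p : X × ℝ | p.2 + K * ‖p.1‖ < 0} :=
    isOpen_lt (by fun_prop) continuous_const
  obtain ⟨f, u, hf1, hf2⟩ := geometric_hahn_banach_open hOc hOo hTc (by
    rw [Set.disjoint_left]
    intro p hp hp'
    have := h p hp'
    simp only [Set.mem_ofPred_eq] at hp
    linarith)
  have hu : u ≤ 0 := by simpa using hf2 0 (Submodule.zero_mem _)
  have hpos : ∀ p ∈ T, 0 ≤ f p := by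
    intro p hp
    by_contra hcon
    push Not at hcon
    have h1 := hf2 _ (hsm ((u - 1) / f p) (div_nonneg_of_nonpos (by linarith) hcon.le) p hp)
    rw [map_smul, smul_eq_mul, div_mul_cancel₀ _ hcon.ne] at h1
    linarith
  have hγ : 0 < f (0, 1) := by
    have h1 := hf1 (0, -1) (by simp)
    have h2 : ((0, -1) : X × ℝ) = -(0, 1) := by simp
    rw [h2, map_neg] at h1
    linarith
  refine ⟨-((f (0, 1))⁻¹ • (f.comp (ContinuousLinearMap.inl ℝ X ℝ))), fun p hp => ?_⟩
  have h1 := hpos p (Submodule.subset_span hp)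
  have h2 : p = (p.1, 0) + p.2 • (0, 1) := by ext <;> simp
  rw [h2, map_add, map_smul, smul_eq_mul] at h1
  simp only [neg_apply, smul_apply, ContinuousLinearMap.comp_apply,
    ContinuousLinearMap.inl_apply, smul_eq_mul]
  have h3 : (f (0, 1))⁻¹ * (f (p.1, 0) + p.2 * f (0, 1)) = (f (0, 1))⁻¹ * f (p.1, 0) + p.2 := by
    field_simp
  have h4 := mul_nonneg (inv_nonneg.2 hγ.le) h1
  linarith

lemma amv_closing {P : Type*} [TopologicalSpace P] [SecondCountableTopology P]
    (U : ℕ → (ℕ → X) → Set (X × P)) (hU : ∀ i z, IsOpen (U i z)) (C : Set X) (hC : C.Countable) :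
    ∃ Y : Submodule ℝ X, IsClosed (Y : Set X) ∧ TopologicalSpace.SeparableSpace Y ∧ C ⊆ Y ∧
      ∀ i z t, t.1 ∈ Y → t ∈ U i z → ∃ z' : ℕ → X, (∀ n, z' n ∈ Y) ∧ t ∈ U i z' := by
  classical
  have h1 : ∀ (i : ℕ) (d : X) (j : ℕ) (B : TopologicalSpace.countableBasis P), ∃ z' : ℕ → X,
      (∃ z, Metric.ball d (1 / ((j : ℝ) + 1)) ×ˢ (B : Set P) ⊆ U i z) →
      Metric.ball d (1 / ((j : ℝ) + 1)) ×ˢ (B : Set P) ⊆ U i z' := by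
    intro i d j B
    by_cases h : ∃ z, Metric.ball d (1 / ((j : ℝ) + 1)) ×ˢ (B : Set P) ⊆ U i z
    · obtain ⟨z, hz⟩ := h
      exact ⟨z, fun _ => hz⟩
    · exact ⟨fun _ => 0, fun h' => absurd h' h⟩
  choose ζ hζ using h1
  have h2 : ∀ S : {S : Set X // S.Countable}, ∃ t : {S : Set X // S.Countable},
      S.1 ⊆ t.1 ∧ (∀ i, ∀ d ∈ S.1, ∀ j B n, ζ i d j B n ∈ t.1) ∧
      (Submodule.span ℝ S.1 : Set X) ⊆ closure t.1 := by
    rintro ⟨S, hS⟩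
    have hsep : TopologicalSpace.IsSeparable (Submodule.span ℝ S : Set X) :=
      hS.isSeparable.span
    obtain ⟨t, -, ht2, ht3⟩ := hsep.exists_countable_dense_subset
    have : Countable (TopologicalSpace.countableBasis P) :=
      (TopologicalSpace.countable_countableBasis P).to_subtype
    refine ⟨⟨S ∪ t ∪ ⋃ i : ℕ, ⋃ d ∈ S, ⋃ j : ℕ, ⋃ B, Set.range (ζ i d j B), ?_⟩, ?_, ?_, ?_⟩
    · refine (hS.union ht2).union ?_
      exact Set.countable_iUnion fun i => hS.biUnion fun d _ => Set.countable_iUnion fun j =>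
        Set.countable_iUnion fun B => Set.countable_range _
    · intro x hx
      exact Or.inl (Or.inl hx)
    · intro i d hd j B n
      refine Or.inr ?_
      simp only [Set.mem_iUnion]
      exact ⟨i, d, hd, j, B, n, rfl⟩
    · refine ht3.trans (closure_mono ?_)
      intro x hx
      exact Or.inl (Or.inr hx)
  choose G hG1 hG2 hG3 using h2
  set D : ℕ → {S : Set X // S.Countable} := fun n => G^[n] ⟨C, hC⟩ with hD
  have hDs : ∀ n, D (n + 1) = G (D n) := fun n => Function.iterate_succ_apply' G n _
  have hmono : Monotone fun n => (D n).1 := monotone_nat_of_le_succ fun n => by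
    rw [hDs]; exact hG1 _
  set E : Set X := ⋃ n, (D n).1 with hE
  have hEc : E.Countable := Set.countable_iUnion fun n => (D n).2
  have hspan : (Submodule.span ℝ E : Set X) ⊆ closure E := by
    intro x hx
    rw [hE, Submodule.span_iUnion] at hx
    rw [SetLike.mem_coe, Submodule.mem_iSup_of_directed _
      (Monotone.directed_le fun m n hmn => Submodule.span_mono (hmono hmn))] at hx
    obtain ⟨n, hn⟩ := hx
    have := hG3 (D n) hn
    rw [← hDs] at this
    exact closure_mono (Set.subset_iUnion (fun n => (D n).1) (n + 1)) this
  refine ⟨(Submodule.span ℝ E).topologicalClosure, Submodule.isClosed_topologicalClosure _, ?_, ?_,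
    ?_⟩
  · have : TopologicalSpace.IsSeparable ((Submodule.span ℝ E).topologicalClosure : Set X) := by
      rw [Submodule.topologicalClosure_coe]
      exact hEc.isSeparable.span.closure
    exact this.separableSpace
  · intro x hx
    exact Submodule.le_topologicalClosure _ (Submodule.subset_span (Set.mem_iUnion.2 ⟨0, hx⟩))
  · rintro i z ⟨y, p⟩ hy ht
    have hy' : y ∈ closure E := by
      have : y ∈ closure (Submodule.span ℝ E : Set X) := by
        rw [← Submodule.topologicalClosure_coe]; exact hy
      exact closure_minimal hspan isClosed_closure this
    obtain ⟨V, W, hV, hW, hyV, hpW, hVW⟩ := isOpen_prod_iff.1 (hU i z) y p ht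
    obtain ⟨B, hB, hpB, hBW⟩ :=
      (TopologicalSpace.isBasis_countableBasis P).exists_subset_of_mem_open hpW hW
    obtain ⟨r, hr, hrV⟩ := Metric.isOpen_iff.1 hV y hyV
    obtain ⟨j, hj⟩ := exists_nat_one_div_lt (half_pos hr)
    have hj0 : (0 : ℝ) < 1 / ((j : ℝ) + 1) := by positivity
    obtain ⟨d, hdE, hd⟩ := Metric.mem_closure_iff.1 hy' _ hj0
    have hsub : Metric.ball d (1 / ((j : ℝ) + 1)) ×ˢ B ⊆ U i z := by
      rintro ⟨x, p'⟩ ⟨hx, hp'⟩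
      refine hVW ⟨hrV ?_, hBW hp'⟩
      rw [Metric.mem_ball] at hx ⊢
      simp only at hx
      have := dist_triangle x d y
      rw [dist_comm] at hd
      linarith
    have hres := hζ i d j ⟨B, hB⟩ ⟨z, hsub⟩
    refine ⟨ζ i d j ⟨B, hB⟩, fun n => ?_, hres ⟨?_, hpB⟩⟩
    · obtain ⟨k, hk⟩ := Set.mem_iUnion.1 hdE
      have := hG2 (D k) i d hk j ⟨B, hB⟩ n
      rw [← hDs] at this
      exact Submodule.le_topologicalClosure _ (Submodule.subset_span (Set.mem_iUnion.2 ⟨_, this⟩))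
    · rw [Metric.mem_ball]; exact hd

end AmvRed
section AmvRed2

open scoped NNReal

variable {X : Type*} [NormedAddCommGroup X] [NormedSpace ℝ X]

lemma amv_ext {α : Type*} (d : α) (n : ℕ) (f : Fin n → α) :
    ∃ g : ℕ → α, ∀ i : Fin n, g i = f i :=
  ⟨fun i => if h : i < n then f ⟨i, h⟩ else d, fun i => by simp⟩

lemma amv_span_pair {V : Type*} [AddCommGroup V] [Module ℝ V] (e1 e2 s : V)
    (hs : s ∈ Submodule.span ℝ≥0 ({e1, -e1, e2, -e2} : Set V)) :
    ∃ α β : ℝ, s = α • e1 + β • e2 := by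
  induction hs using Submodule.span_induction with
  | mem x hx =>
    simp only [Set.mem_insert_iff, Set.mem_singleton_iff] at hx
    rcases hx with rfl | rfl | rfl | rfl
    · exact ⟨1, 0, by simp⟩
    · exact ⟨-1, 0, by simp⟩
    · exact ⟨0, 1, by simp⟩
    · exact ⟨0, -1, by simp⟩
  | zero => exact ⟨0, 0, by simp⟩
  | add x y _ _ hx hy =>
    obtain ⟨α, β, rfl⟩ := hx
    obtain ⟨α', β', rfl⟩ := hy
    exact ⟨α + α', β + β', by rw [add_smul, add_smul]; abel⟩
  | smul r x _ hx =>
    obtain ⟨α, β, rfl⟩ := hx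
    exact ⟨r * α, r * β, by rw [NNReal.smul_def, smul_add, smul_smul, smul_smul]⟩

/-- The open sets of parameters used in the separable reduction. -/
def amvU (φ : X → EReal) (w c : X) (m : ℕ) (z : ℕ → X) :
    Set (X × ((ℕ → ℝ) × (ℕ → ℝ) × (ℕ → ℝ) × ℝ × ℝ × ℝ × ℝ)) :=
  {t | (∀ i : Fin m, φ (z i) ≠ ⊤ ∧ ‖z i - t.1‖ < t.2.2.2.1 i) ∧
    (∑ i : Fin m, (t.2.1 i * (φ (z i)).toReal + t.2.2.1 i * ‖z i - t.1‖)) + t.2.2.2.2.1 +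
      t.2.2.2.2.2.2.2 * ‖(∑ i : Fin m, t.2.1 i • (z i - t.1)) + t.2.2.2.2.2.1 • w +
        t.2.2.2.2.2.2.1 • (c - t.1)‖ < 0}

lemma amvU_open (φ : X → EReal) (w c : X) (m : ℕ) (z : ℕ → X) : IsOpen (amvU φ w c m z) := by
  refine IsOpen.and ?_ ?_
  · simp only [Set.ofPred_forall]
    refine isOpen_iInter_of_finite fun i => ?_
    by_cases h : φ (z i) = ⊤
    · simp [h]
    · simp only [ne_eq, h, not_false_eq_true, true_and]
      exact isOpen_lt (by fun_prop) (by fun_prop)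
  · refine isOpen_lt ?_ continuous_const
    fun_prop

lemma amv_reduction (φ : X → EReal) (hnobot : ∀ x, φ x ≠ ⊥) (w c : X) (C : Set X)
    (hC : C.Countable) :
    ∃ Y : Submodule ℝ X, IsClosed (Y : Set X) ∧ TopologicalSpace.SeparableSpace Y ∧ C ⊆ Y ∧
      ∀ (hw : w ∈ Y) (hc : c ∈ Y) (y : Y), ∀ ys ∈ FrechetSubdiff (fun z : Y => φ z) y,
        ∃ xs ∈ FrechetSubdiff φ (y : X), xs w = ys ⟨w, hw⟩ ∧
          xs (c - y) = ys (⟨c, hc⟩ - y) := by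
  obtain ⟨Y, hYc, hYs, hCY, hY⟩ := amv_closing (amvU φ w c) (amvU_open φ w c) C hC
  refine ⟨Y, hYc, hYs, hCY, ?_⟩
  intro hw hc y ys hys
  obtain ⟨hytop, hsub⟩ := hys
  have hreal : ∀ x, φ x ≠ ⊤ → φ x = ((φ x).toReal : EReal) := fun x hx =>
    (EReal.coe_toReal hx (hnobot x)).symm
  set q := (φ y).toReal with hq
  have hφy : φ y = (q : EReal) := hreal _ hytop
  have hδ : ∀ n : ℕ, ∃ δ > 0, ∀ z : Y, ‖z - y‖ < δ → φ z ≠ ⊤ →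
      q + ys (z - y) - 1 / ((n : ℝ) + 1) * ‖z - y‖ ≤ (φ z).toReal := by
    intro n
    obtain ⟨δ, hδ, h⟩ := Metric.eventually_nhds_iff.1 (hsub (1 / ((n : ℝ) + 1)) (by positivity))
    refine ⟨δ, hδ, fun z hz hzt => ?_⟩
    have := h (y := z) (by rwa [dist_eq_norm])
    beta_reduce at this
    rw [hφy, hreal _ hzt, ← EReal.coe_add, ← EReal.coe_sub, EReal.coe_le_coe_iff] at this
    exact this
  choose δ hδ0 hδ using hδ
  set A₀ : Set (X × ℝ) := {p | ∃ (z : X) (n : ℕ), φ z ≠ ⊤ ∧ ‖z - y‖ < δ n ∧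
    p = (z - y, (φ z).toReal - q + 1 / ((n : ℝ) + 1) * ‖z - y‖)} with hA₀
  set e1 : X × ℝ := (w, ys ⟨w, hw⟩) with he1
  set e2 : X × ℝ := (c - y, ys (⟨c, hc⟩ - y)) with he2
  obtain ⟨xs, hxs⟩ := amv_hb (A₀ ∪ {e1, -e1, e2, -e2}) ‖ys‖ (norm_nonneg _) (by
    intro p hp
    rw [Submodule.span_union] at hp
    obtain ⟨s, hs, s', hs', rfl⟩ := Submodule.mem_sup.1 hp
    obtain ⟨α, β, rfl⟩ := amv_span_pair e1 e2 s' hs'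
    obtain ⟨n, f, g, rfl⟩ := Submodule.mem_span_set'.1 hs
    have hg : ∀ i, ∃ (z : X) (n : ℕ), φ z ≠ ⊤ ∧ ‖z - y‖ < δ n ∧
      (g i : X × ℝ) = (z - y, (φ z).toReal - q + 1 / ((n : ℝ) + 1) * ‖z - y‖) :=
      fun i => (g i).2
    choose z k hz1 hz2 hz3 using hg
    obtain ⟨zz, hzz⟩ := amv_ext 0 n z
    obtain ⟨lam, hlam⟩ := amv_ext 0 n (fun i => (f i : ℝ))
    obtain ⟨mu, hmu⟩ := amv_ext 0 n (fun i => (f i : ℝ) * (1 / ((k i : ℝ) + 1)))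
    obtain ⟨dl, hdl⟩ := amv_ext 0 n (fun i => δ (k i))
    by_contra hcon
    push Not at hcon
    obtain ⟨z', hz'Y, hz'⟩ := hY n zz ((y : X), (lam, mu, dl,
      -(∑ i : Fin n, (f i : ℝ) * q) + α * ys ⟨w, hw⟩ + β * ys (⟨c, hc⟩ - y), α, β, ‖ys‖)) y.2 (by
        refine ⟨fun i => ?_, ?_⟩
        · simp only [hzz, hdl]
          exact ⟨hz1 i, hz2 i⟩
        · simp only [hzz, hlam, hmu]
          refine lt_of_eq_of_lt ?_ hcon
          simp only [hz3, he1, he2, NNReal.smul_def, Prod.smul_mk, Prod.fst_add, Prod.snd_add,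
            Prod.fst_sum, Prod.snd_sum, smul_eq_mul, add_assoc]
          rw [← add_assoc (∑ i, _) (-_), ← sub_eq_add_neg, ← Finset.sum_sub_distrib]
          congr 1
          refine Finset.sum_congr rfl fun i _ => ?_
          ring)
    obtain ⟨h1, h2⟩ := hz'
    simp only [hlam, hmu, hdl] at h1 h2
    set Z : Fin n → Y := fun i => ⟨z' i, hz'Y i⟩ with hZ
    have h3 : ∀ i : Fin n, (f i : ℝ) * q + (f i : ℝ) * ys (Z i - y) ≤
        (f i : ℝ) * (φ (z' i)).toReal + (f i : ℝ) * (1 / ((k i : ℝ) + 1)) * ‖z' i - y‖ := by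
      intro i
      have := hδ (k i) (Z i) (h1 i).2 (h1 i).1
      have h4 : ‖z' i - y‖ = ‖Z i - y‖ := rfl
      have h5 : φ (z' i) = φ (Z i) := rfl
      rw [h4, h5]
      have := mul_le_mul_of_nonneg_left this (f i).2
      simp only [NNReal.val_eq_coe] at this
      linarith
    have h4 := Finset.sum_le_sum fun i (_ : i ∈ Finset.univ) => h3 i
    rw [Finset.sum_add_distrib] at h4
    set V : Y := (∑ i : Fin n, (f i : ℝ) • (Z i - y)) + α • ⟨w, hw⟩ + β • (⟨c, hc⟩ - y) with hV
    have h5 : ys V = (∑ i : Fin n, (f i : ℝ) * ys (Z i - y)) + α * ys ⟨w, hw⟩ +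
        β * ys (⟨c, hc⟩ - y) := by
      simp only [hV, map_add, map_sum, map_smul, smul_eq_mul]
    have h6 : ‖(∑ i : Fin n, (f i : ℝ) • (z' i - (y : X))) + α • w + β • (c - (y : X))‖ = ‖V‖ := by
      rw [Submodule.coe_norm]
      simp [hV, hZ]
    rw [h6] at h2
    have h7 := (abs_le.1 (ys.le_opNorm V)).1
    linarith)
  have hp1 := hxs e1 (Or.inr (by simp))
  have hm1 := hxs (-e1) (Or.inr (by simp))
  have hp2 := hxs e2 (Or.inr (by simp))
  have hm2 := hxs (-e2) (Or.inr (by simp))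
  simp only [he1, he2, Prod.fst_neg, Prod.snd_neg, map_neg, neg_le_neg_iff] at hp1 hm1 hp2 hm2
  refine ⟨xs, ⟨hytop, fun ε hε => ?_⟩, le_antisymm hp1 hm1, le_antisymm hp2 hm2⟩
  obtain ⟨n, hn⟩ := exists_nat_one_div_lt hε
  filter_upwards [Metric.ball_mem_nhds (y : X) (hδ0 n)] with z hz
  by_cases hzt : φ z = ⊤
  · rw [hzt]; exact le_top
  rw [Metric.mem_ball, dist_eq_norm] at hz
  have h := hxs _ (Or.inl ⟨z, n, hzt, hz, rfl⟩)
  simp only at h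
  rw [hφy, hreal _ hzt, ← EReal.coe_add, ← EReal.coe_sub, EReal.coe_le_coe_iff]
  have := mul_le_mul_of_nonneg_right hn.le (norm_nonneg (z - y))
  linarith

end AmvRed2
section AmvMain

variable {X : Type*} [NormedAddCommGroup X] [NormedSpace ℝ X]

lemma amv_asplund [CompleteSpace X] (hX : IsAsplund X) (φ : X → EReal) (hnobot : ∀ x, φ x ≠ ⊥)
    (hlsc : LowerSemicontinuous φ) (a b : X) (hab : a ≠ b) (tc : ℝ) (htc0 : 0 ≤ tc) (htc1 : tc < 1)
    (c : X) (hcdef : c = a + tc • (b - a)) (m : ℝ) (hc : φ c = m)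
    (hseg : ∀ s ∈ Set.Icc (0 : ℝ) 1, (m : EReal) ≤ φ (a + s • (b - a))) (ε : ℝ) (hε : 0 < ε) :
    ∃ x, ∃ u ∈ FrechetSubdiff φ x, ∃ v : ℝ, φ x = v ∧ |v - m| < ε ∧ ‖x - c‖ < ε ∧
      -ε < u (b - a) ∧ -ε < u (b - x) ∧ (0 < tc → |u (b - a)| < ε) := by
  obtain ⟨Y, hYc, hYs, hCY, hY⟩ := amv_reduction φ hnobot (b - a) c {a, b} (by simp)
  have ha : a ∈ Y := hCY (by simp)
  have hb : b ∈ Y := hCY (by simp)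
  have hw : b - a ∈ Y := Y.sub_mem hb ha
  have hcY : c ∈ Y := by rw [hcdef]; exact Y.add_mem ha (Y.smul_mem _ hw)
  have hdual := hX Y hYc hYs
  have : CompleteSpace Y := hYc.completeSpace_coe
  obtain ⟨x, u, hu, v, h1, h2, h3, h4, h5, h6⟩ := amv_sep (fun z : Y => φ z) (fun z => hnobot z)
    (fun z r hr => continuous_subtype_val.continuousAt.eventually (hlsc _ r hr)) ⟨a, ha⟩ ⟨b, hb⟩
    (fun h => hab (congrArg Subtype.val h)) tc htc0 htc1 ⟨c, hcY⟩ (Subtype.ext hcdef) m hc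
    (fun s hs => hseg s hs) ε hε
  obtain ⟨xs, hxs, e1, e2⟩ := hY hw hcY x u hu
  have e1' : xs (b - a) = u (⟨b, hb⟩ - ⟨a, ha⟩) := e1
  have e3 : xs (b - x) = u (⟨b, hb⟩ - x) := by
    have k1 : b - (x : X) = (1 - tc) • (b - a) + (c - x) := by
      rw [hcdef, sub_smul, one_smul]; abel
    have k2 : (⟨b, hb⟩ : Y) - x = (1 - tc) • (⟨b, hb⟩ - ⟨a, ha⟩) + (⟨c, hcY⟩ - x) :=
      Subtype.ext k1
    rw [k1, k2, map_add, map_add, map_smul, map_smul, e1', e2]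
  refine ⟨x, xs, hxs, v, h1, h2, h3, ?_, ?_, ?_⟩
  · rw [e1']; exact h4
  · rw [e3]; exact h5
  · rw [e1']; exact h6

lemma amv_liminf (u r : ℕ → ℝ) (R : ℝ) (hr : Tendsto r atTop (𝓝 R)) (hru : ∀ k, r k ≤ u k) :
    (R : EReal) ≤ liminf (fun k => (u k : EReal)) atTop := by
  have h : Tendsto (fun k => (r k : EReal)) atTop (𝓝 (R : EReal)) :=
    (continuous_coe_real_ereal.tendsto R).comp hr
  rw [← h.liminf_eq]
  exact liminf_le_liminf (Eventually.of_forall fun k => EReal.coe_le_coe_iff.2 (hru k))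

lemma amv_subdiff_shift (φ : X → EReal) (f : X →L[ℝ] ℝ) (a x : X) (u : X →L[ℝ] ℝ)
    (hnobot : ∀ x, φ x ≠ ⊥)
    (hu : u ∈ FrechetSubdiff (fun x => φ x + ((-f (x - a) : ℝ) : EReal)) x) :
    u + f ∈ FrechetSubdiff φ x := by
  obtain ⟨h1, h2⟩ := hu
  have hx : φ x ≠ ⊤ := by
    intro h
    apply h1
    simp only [h]
    exact EReal.top_add_coe _
  refine ⟨hx, fun ε hε => ?_⟩
  filter_upwards [h2 ε hε] with y hy
  by_cases hyt : φ y = ⊤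
  · rw [hyt]; exact le_top
  beta_reduce at hy
  rw [← EReal.coe_toReal hx (hnobot x), ← EReal.coe_toReal hyt (hnobot y)] at hy ⊢
  simp only [← EReal.coe_add, ← EReal.coe_sub, EReal.coe_le_coe_iff, add_apply] at hy ⊢
  have : f (y - x) = f (y - a) - f (x - a) := by rw [← map_sub]; congr 1; abel
  linarith

end AmvMain

/-- Approximate mean value theorem (Theorem 2.3 / Mordukhovich Thm 3.49):
in an Asplund space, for a proper lsc `φ` finite at `a ≠ b`, the function
`ψ x = φ x - ((φ b - φ a)/‖a - b‖) * ‖x - a‖` attains its minimum over `[a,b]` at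
some `c ∈ [a,b)`, and for any such `c` there are sequences `xₖ →_φ c`,
`xₖ* ∈ ∂̂φ(xₖ)` with the stated liminf and limit properties. -/
theorem approximate_mean_value_theorem
    {X : Type*} [NormedAddCommGroup X] [NormedSpace ℝ X] [CompleteSpace X]
    (hX : IsAsplund X) (φ : X → EReal)
    (hproper : ∃ x, φ x ≠ ⊤) (hnobot : ∀ x, φ x ≠ ⊥)
    (hlsc : LowerSemicontinuous φ)
    (a b : X) (hab : a ≠ b) (ra rb : ℝ) (hfa : φ a = ↑ra) (hfb : φ b = ↑rb) :
    (∃ c, (∃ t : ℝ, 0 ≤ t ∧ t < 1 ∧ c = a + t • (b - a)) ∧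
      ∀ x ∈ segment ℝ a b,
        φ c - ↑((rb - ra) / ‖a - b‖ * ‖c - a‖) ≤ φ x - ↑((rb - ra) / ‖a - b‖ * ‖x - a‖)) ∧
    (∀ c, (∃ t : ℝ, 0 ≤ t ∧ t < 1 ∧ c = a + t • (b - a)) →
      (∀ x ∈ segment ℝ a b,
        φ c - ↑((rb - ra) / ‖a - b‖ * ‖c - a‖) ≤ φ x - ↑((rb - ra) / ‖a - b‖ * ‖x - a‖)) →
      ∃ (xk : ℕ → X) (xks : ℕ → X →L[ℝ] ℝ),
        (∀ k, xks k ∈ FrechetSubdiff φ (xk k)) ∧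
        Tendsto xk atTop (𝓝 c) ∧
        Tendsto (fun k => φ (xk k)) atTop (𝓝 (φ c)) ∧
        (↑((rb - ra) / ‖a - b‖ * ‖b - c‖) : EReal) ≤
          liminf (fun k => (↑(xks k (b - xk k)) : EReal)) atTop ∧
        (↑(rb - ra) : EReal) ≤ liminf (fun k => (↑(xks k (b - a)) : EReal)) atTop ∧
        (c ≠ a → Tendsto (fun k => xks k (b - a)) atTop (𝓝 (rb - ra)))) := by
  set w := b - a with hw
  have hw0 : w ≠ 0 := sub_ne_zero.2 hab.symm
  have hwn : ‖w‖ ≠ 0 := norm_ne_zero_iff.2 hw0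
  have hnab : ‖a - b‖ = ‖w‖ := norm_sub_rev a b
  obtain ⟨g, -, hg⟩ := exists_dual_vector ℝ w hwn
  set f : X →L[ℝ] ℝ := ((rb - ra) / ‖w‖) • g with hf
  have hfw : f w = rb - ra := by
    rw [hf, smul_apply, hg, smul_eq_mul]
    simp only [RCLike.ofReal_real_eq_id, id_eq]
    field_simp
  set φ' : X → EReal := fun x => φ x + ((-f (x - a) : ℝ) : EReal) with hφ'
  have hφ'bot : ∀ x, φ' x ≠ ⊥ := by
    intro x
    simp only [hφ', ne_eq, EReal.add_eq_bot_iff, not_or]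
    exact ⟨hnobot x, EReal.coe_ne_bot _⟩
  have hφ'lsc : LowerSemicontinuous φ' := by
    refine LowerSemicontinuous.add' hlsc ?_ ?_
    · refine Continuous.lowerSemicontinuous ?_
      exact continuous_coe_real_ereal.comp (by fun_prop)
    · intro x
      exact EReal.continuousAt_add (Or.inr (EReal.coe_ne_bot _)) (Or.inr (EReal.coe_ne_top _))
  have hval : ∀ s : ℝ, 0 ≤ s →
      (rb - ra) / ‖a - b‖ * ‖(a + s • w) - a‖ = f ((a + s • w) - a) := by
    intro s hs
    rw [add_sub_cancel_left, norm_smul, map_smul, hfw, hnab, Real.norm_eq_abs, abs_of_nonneg hs,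
      smul_eq_mul]
    field_simp
  have hψ : ∀ s : ℝ, 0 ≤ s →
      φ (a + s • w) - ↑((rb - ra) / ‖a - b‖ * ‖(a + s • w) - a‖) = φ' (a + s • w) := by
    intro s hs
    rw [hval s hs, sub_eq_add_neg, ← EReal.coe_neg]
  have hφ'a : φ' a = ra := by simp [hφ', hfa]
  have hφ'b : φ' b = ra := by
    simp only [hφ', hfb, ← hw, hfw]
    rw [← EReal.coe_add]
    congr 1; ring
  refine ⟨?_, ?_⟩
  · have hK : IsCompact ((fun θ : ℝ => a + θ • w) '' Set.Icc (0 : ℝ) 1) :=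
      isCompact_Icc.image (by fun_prop)
    obtain ⟨c, ⟨s, hs, rfl⟩, hmin⟩ := LowerSemicontinuousOn.exists_isMinOn
      ((Set.nonempty_Icc.2 zero_le_one).image _) hK (hφ'lsc.lowerSemicontinuousOn _)
    have hmin' : ∀ θ ∈ Set.Icc (0 : ℝ) 1, φ' (a + s • w) ≤ φ' (a + θ • w) :=
      fun θ hθ => hmin ⟨θ, hθ, rfl⟩
    obtain ⟨s', hs'0, hs'1, hs'⟩ : ∃ s' : ℝ, 0 ≤ s' ∧ s' < 1 ∧
        φ' (a + s' • w) = φ' (a + s • w) := by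
      rcases hs.2.lt_or_eq with h | h
      · exact ⟨s, hs.1, h, rfl⟩
      · refine ⟨0, le_rfl, one_pos, ?_⟩
        rw [h, zero_smul, add_zero, one_smul, hw, add_sub_cancel, hφ'a, hφ'b]
    refine ⟨a + s' • w, ⟨s', hs'0, hs'1, rfl⟩, fun x hx => ?_⟩
    rw [segment_eq_image'] at hx
    obtain ⟨θ, hθ, rfl⟩ := hx
    change _ ≤ φ (a + θ • w) - ↑((rb - ra) / ‖a - b‖ * ‖(a + θ • w) - a‖)
    rw [hψ s' hs'0, hψ θ hθ.1, hs']
    exact hmin' θ hθ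
  · rintro c ⟨tc, htc0, htc1, hcdef⟩ hmin
    have hmin' : ∀ θ ∈ Set.Icc (0 : ℝ) 1, φ' c ≤ φ' (a + θ • w) := by
      intro θ hθ
      have := hmin (a + θ • w) (by rw [segment_eq_image']; exact ⟨θ, hθ, rfl⟩)
      rw [hψ θ hθ.1] at this
      rw [hcdef] at this ⊢
      rwa [hψ tc htc0] at this
    have hctop : φ' c ≠ ⊤ := by
      have := hmin' 0 (by simp)
      rw [zero_smul, add_zero, hφ'a] at this
      exact ne_top_of_le_ne_top (EReal.coe_ne_top _) this
    set m := (φ' c).toReal with hm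
    have hφ'c : φ' c = m := (EReal.coe_toReal hctop (hφ'bot c)).symm
    have hback : ∀ x (v : ℝ), φ' x = v → φ x = ((v + f (x - a) : ℝ) : EReal) := by
      intro x v hv
      have hxt : φ x ≠ ⊤ := by
        intro h
        simp only [hφ', h, EReal.top_add_coe] at hv
        exact EReal.coe_ne_top _ hv.symm
      rw [← EReal.coe_toReal hxt (hnobot x)]
      simp only [hφ'] at hv
      rw [← EReal.coe_toReal hxt (hnobot x), ← EReal.coe_add, EReal.coe_eq_coe_iff] at hv
      rw [EReal.coe_eq_coe_iff]
      linarith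
    have key : ∀ k : ℕ, _ := fun k => amv_asplund hX φ' hφ'bot hφ'lsc a b hab tc htc0 htc1 c hcdef
      m hφ'c (fun s hs => by rw [← hφ'c]; exact hmin' s hs) (1 / ((k : ℝ) + 1)) (by positivity)
    choose x u hu v h1 h2 h3 h4 h5 h6 using key
    have hlim : Tendsto (fun k : ℕ => 1 / ((k : ℝ) + 1)) atTop (𝓝 0) :=
      tendsto_one_div_add_atTop_nhds_zero_nat
    have hxc : Tendsto x atTop (𝓝 c) := by
      rw [tendsto_iff_norm_sub_tendsto_zero]
      exact squeeze_zero (fun k => norm_nonneg _) (fun k => (h3 k).le) hlim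
    have hvm : Tendsto v atTop (𝓝 m) := by
      rw [tendsto_iff_norm_sub_tendsto_zero]
      exact squeeze_zero (fun k => norm_nonneg _) (fun k => (h2 k).le) hlim
    refine ⟨x, fun k => u k + f, fun k => amv_subdiff_shift φ f a (x k) (u k) hnobot (hu k), hxc,
      ?_, ?_, ?_, ?_⟩
    · rw [hback c m hφ'c]
      have : (fun k => φ (x k)) = fun k => ((v k + f (x k - a) : ℝ) : EReal) :=
        funext fun k => hback _ _ (h1 k)
      rw [this]
      refine (continuous_coe_real_ereal.tendsto _).comp ?_
      exact hvm.add ((f.continuous.tendsto _).comp (hxc.sub_const a))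
    · have hR : (rb - ra) / ‖a - b‖ * ‖b - c‖ = f (b - c) := by
        have : b - c = (1 - tc) • w := by rw [hcdef, sub_smul, one_smul, hw]; abel
        rw [this, norm_smul, map_smul, hfw, hnab, Real.norm_eq_abs,
          abs_of_nonneg (by linarith), smul_eq_mul]
        field_simp
      rw [hR]
      refine amv_liminf _ (fun k : ℕ => f (b - x k) - 1 / ((k : ℝ) + 1)) _ ?_ fun k => ?_
      · have := ((f.continuous.tendsto _).comp (hxc.const_sub b)).sub hlim
        rw [sub_zero] at this
        exact this
      · have := h5 k
        rw [add_apply]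
        linarith
    · refine amv_liminf _ (fun k : ℕ => (rb - ra) - 1 / ((k : ℝ) + 1)) _ ?_ fun k => ?_
      · have := hlim.const_sub (rb - ra)
        rw [sub_zero] at this
        exact this
      · have := h4 k
        rw [add_apply, hfw]
        linarith
    · intro hca
      have htc : 0 < tc := by
        refine lt_of_le_of_ne htc0 fun h => hca ?_
        rw [hcdef, ← h, zero_smul, add_zero]
      have h0 : Tendsto (fun k => u k w) atTop (𝓝 0) :=
        squeeze_zero_norm (fun k => (h6 k htc).le) hlim
      have := h0.add_const (rb - ra)
      rw [zero_add] at this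
      refine this.congr fun k => ?_
      rw [add_apply, hfw]
end

section
/- Let X be an Asplund space and φ : X → ℝ ∪ {+∞} a proper lower semicontinuous function. Let u, v, w ∈ X be such that v ∈ [u,w] and φ(v) > φ(u), and let λ > 0. Then there exist x̄ ∈ dom φ and x̄* ∈ ∂̂φ(x̄) such that x̄ ∈ B_λ([u,v]) and ⟨x̄*, w − x̄⟩ > 0, where B_λ([u,v]) := {x ∈ X : there exists y ∈ [u,v] with ‖x − y‖ < λ}. -/
open Filter Topology

noncomputable section ThreePointsAux

/-- seminorm of the restriction of a functional to the kernel of another one -/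
def kerNorm {E : Type*} [NormedAddCommGroup E] [NormedSpace ℝ E]
    (g f : StrongDual ℝ E) : ℝ := ‖f.comp (LinearMap.ker g.toLinearMap).subtypeL‖

section
variable {E : Type*} [NormedAddCommGroup E] [NormedSpace ℝ E]

lemma kerNorm_nonneg (g f : StrongDual ℝ E) : 0 ≤ kerNorm g f := by
  exact ContinuousLinearMap.opNorm_nonneg _

lemma kerNorm_apply (g f : StrongDual ℝ E) (z : E) (hz : g z = 0) :
    |f z| ≤ kerNorm g f * ‖z‖ := by
  have := (f.comp (LinearMap.ker g.toLinearMap).subtypeL).le_opNorm ⟨z, by simpa using hz⟩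
  simpa [kerNorm] using this

lemma kerNorm_le_of (g f : StrongDual ℝ E) (M : ℝ) (hM : 0 ≤ M)
    (h : ∀ z, g z = 0 → |f z| ≤ M * ‖z‖) : kerNorm g f ≤ M := by
  apply ContinuousLinearMap.opNorm_le_bound _ hM
  rintro ⟨z, hz⟩
  simpa using h z (by simpa using hz)

lemma kerNorm_le (g f : StrongDual ℝ E) : kerNorm g f ≤ ‖f‖ :=
  kerNorm_le_of g f _ (norm_nonneg _) (fun z _ => f.le_opNorm z)

lemma kerNorm_mid (g f f' : StrongDual ℝ E) :
    kerNorm g ((1/2 : ℝ) • (f + f')) ≤ (kerNorm g f + kerNorm g f') / 2 := by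
  have h1 := kerNorm_nonneg g f
  have h2 := kerNorm_nonneg g f'
  apply kerNorm_le_of _ _ _ (by positivity)
  intro z hz
  have h3 := kerNorm_apply g f z hz
  have h4 := kerNorm_apply g f' z hz
  have : |f z + f' z| ≤ |f z| + |f' z| := abs_add_le _ _
  simp only [smul_apply, add_apply, smul_eq_mul, abs_mul]
  rw [abs_of_pos (by norm_num : (0:ℝ) < 1/2)]
  linarith

/-- single term of the penalty -/
def tm (g : StrongDual ℝ E) (x : E) (f : StrongDual ℝ E) : ℝ := kerNorm g f ^ 2 + (f x) ^ 2

lemma tm_nonneg (g : StrongDual ℝ E) (x : E) (f : StrongDual ℝ E) : 0 ≤ tm g x f := by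
  unfold tm; positivity

lemma tm_le (g : StrongDual ℝ E) (x : E) (hx : ‖x‖ ≤ 1) (f : StrongDual ℝ E) :
    tm g x f ≤ 2 * ‖f‖ ^ 2 := by
  have h1 := kerNorm_le g f
  have h2 := kerNorm_nonneg g f
  have h3 : |f x| ≤ ‖f‖ := by
    have := f.le_opNorm x
    rw [Real.norm_eq_abs] at this
    nlinarith [norm_nonneg f]
  have h4 : (f x) ^ 2 ≤ ‖f‖ ^ 2 := by rw [← sq_abs]; gcongr
  unfold tm
  nlinarith

lemma tm_mid (g : StrongDual ℝ E) (x : E) (f f' : StrongDual ℝ E) :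
    tm g x ((1/2 : ℝ) • (f + f')) + (kerNorm g f - kerNorm g f') ^ 2 / 4 + (f x - f' x) ^ 2 / 4
      ≤ (tm g x f + tm g x f') / 2 := by
  have h1 := kerNorm_mid g f f'
  have h2 := kerNorm_nonneg g ((1/2 : ℝ) • (f + f'))
  have h3 : kerNorm g ((1/2 : ℝ) • (f + f')) ^ 2 ≤ ((kerNorm g f + kerNorm g f') / 2) ^ 2 := by
    gcongr
  unfold tm
  simp only [smul_apply, add_apply, smul_eq_mul]
  nlinarith

/-- the penalty on the dual -/
def pen (F : ℕ → StrongDual ℝ E) (x : ℕ → E) (f : StrongDual ℝ E) : ℝ :=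
  ‖f‖ ^ 2 + ∑' n, (1/2 : ℝ) ^ n * tm (F n) (x n) f

lemma pen_summable (F : ℕ → StrongDual ℝ E) (x : ℕ → E) (hx : ∀ n, ‖x n‖ ≤ 1)
    (f : StrongDual ℝ E) : Summable fun n => (1/2 : ℝ) ^ n * tm (F n) (x n) f := by
  refine Summable.of_nonneg_of_le (fun n => mul_nonneg (by positivity) (tm_nonneg _ _ _))
    (fun n => mul_le_mul_of_nonneg_left (tm_le _ _ (hx n) f) (by positivity)) ?_
  exact summable_geometric_two.mul_right _

lemma pen_ge (F : ℕ → StrongDual ℝ E) (x : ℕ → E) (f : StrongDual ℝ E) : ‖f‖ ^ 2 ≤ pen F x f := by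
  have : 0 ≤ ∑' n, (1/2 : ℝ) ^ n * tm (F n) (x n) f :=
    tsum_nonneg fun n => mul_nonneg (by positivity) (tm_nonneg _ _ _)
  unfold pen; linarith

lemma pen_le (F : ℕ → StrongDual ℝ E) (x : ℕ → E) (hx : ∀ n, ‖x n‖ ≤ 1)
    (f : StrongDual ℝ E) : pen F x f ≤ 5 * ‖f‖ ^ 2 := by
  have h := Summable.tsum_le_tsum (f := fun n => (1/2 : ℝ) ^ n * tm (F n) (x n) f)
    (fun n => mul_le_mul_of_nonneg_left (tm_le _ _ (hx n) f) (by positivity))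
    (pen_summable F x hx f) (summable_geometric_two.mul_right (2 * ‖f‖ ^ 2))
  rw [tsum_mul_right, tsum_geometric_two] at h
  unfold pen; linarith

lemma pen_mid (F : ℕ → StrongDual ℝ E) (x : ℕ → E) (hx : ∀ n, ‖x n‖ ≤ 1)
    (f f' : StrongDual ℝ E) (n : ℕ) :
    pen F x ((1/2 : ℝ) • (f + f')) + (1/2 : ℝ) ^ n *
      ((kerNorm (F n) f - kerNorm (F n) f') ^ 2 / 4 + (f (x n) - f' (x n)) ^ 2 / 4)
      ≤ (pen F x f + pen F x f') / 2 := by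
  set m := (1/2 : ℝ) • (f + f') with hm
  have s1 := pen_summable F x hx f
  have s2 := pen_summable F x hx f'
  have s3 := pen_summable F x hx m
  have s4 := ((s1.add s2).mul_right (1/2)).sub s3
  have key : ∀ k, (1/2 : ℝ) ^ k * ((kerNorm (F k) f - kerNorm (F k) f') ^ 2 / 4 + (f (x k) - f' (x k)) ^ 2 / 4)
      ≤ ((1/2 : ℝ) ^ k * tm (F k) (x k) f + (1/2 : ℝ) ^ k * tm (F k) (x k) f') * (1/2)
        - (1/2 : ℝ) ^ k * tm (F k) (x k) m := by
    intro k
    have := mul_le_mul_of_nonneg_left (tm_mid (F k) (x k) f f') (by positivity : (0:ℝ) ≤ (1/2)^k)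
    rw [← hm] at this
    linarith
  have h1 := s4.le_tsum n (fun j _ => le_trans (by positivity) (key j))
  have h2 := (key n).trans h1
  rw [((s1.add s2).mul_right (1/2)).tsum_sub s3, tsum_mul_right, s1.tsum_add s2] at h2
  have h3 : ‖m‖ ^ 2 ≤ (‖f‖ ^ 2 + ‖f'‖ ^ 2) / 2 := by
    have : ‖m‖ ≤ (‖f‖ + ‖f'‖) / 2 := by
      rw [hm, norm_smul]
      have := norm_add_le f f'
      norm_num; linarith
    nlinarith [norm_nonneg m, sq_nonneg (‖f‖ - ‖f'‖)]
  unfold pen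
  linarith

/-- lower semicontinuity of squared sup-type seminorms -/
lemma lsc_aux (g : StrongDual ℝ E) :
    LowerSemicontinuous fun f : WeakDual ℝ E => kerNorm g (WeakDual.toStrongDual f) ^ 2 := by
  intro f y hy
  by_cases hy0 : y < 0
  · exact Eventually.of_forall fun f' => lt_of_lt_of_le hy0 (sq_nonneg _)
  push Not at hy0
  have h1 : Real.sqrt y < kerNorm g (WeakDual.toStrongDual f) :=
    (Real.sqrt_lt' (lt_of_le_of_ne (kerNorm_nonneg _ _) (by
      intro h; change y < kerNorm g (WeakDual.toStrongDual f) ^ 2 at hy; rw [← h] at hy; simp at hy; linarith))).2 hy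
  obtain ⟨z, hz1, hz2⟩ := ContinuousLinearMap.exists_lt_apply_of_lt_opNorm _ h1
  have hc : Continuous fun f' : WeakDual ℝ E => |f' (z : E)| :=
    (WeakDual.eval_continuous (z : E)).abs
  have hz2' : Real.sqrt y < |f (z : E)| := hz2
  filter_upwards [hc.continuousAt.eventually (lt_mem_nhds hz2')] with f' hf'
  have h2 : |f' (z : E)| ≤ kerNorm g (WeakDual.toStrongDual f') := by
    refine (kerNorm_apply g (WeakDual.toStrongDual f') z z.2).trans ?_
    have := kerNorm_nonneg g (WeakDual.toStrongDual f')
    have hz3 : ‖(z : E)‖ < 1 := hz1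
    nlinarith
  have h3 := lt_of_lt_of_le hf' h2
  calc y = Real.sqrt y ^ 2 := (Real.sq_sqrt hy0).symm
    _ < _ := by gcongr

lemma lsc_norm :
    LowerSemicontinuous fun f : WeakDual ℝ E => ‖WeakDual.toStrongDual f‖ ^ 2 := by
  have h := lsc_aux (0 : StrongDual ℝ E)
  have : ∀ f : StrongDual ℝ E, kerNorm 0 f = ‖f‖ := fun f => by
    apply le_antisymm (kerNorm_le _ _)
    exact ContinuousLinearMap.opNorm_le_bound _ (kerNorm_nonneg _ _)
      (fun z => kerNorm_apply 0 f z (by simp))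
  simpa only [this] using h

lemma pen_lsc (F : ℕ → StrongDual ℝ E) (x : ℕ → E) (hx : ∀ n, ‖x n‖ ≤ 1) :
    LowerSemicontinuous fun f : WeakDual ℝ E => pen F x (WeakDual.toStrongDual f) := by
  have hpart : ∀ N : ℕ, LowerSemicontinuous fun f : WeakDual ℝ E =>
      ‖WeakDual.toStrongDual f‖ ^ 2 +
        ∑ n ∈ Finset.range N, (1/2 : ℝ) ^ n * tm (F n) (x n) (WeakDual.toStrongDual f) := by
    intro N
    refine lsc_norm.add (lowerSemicontinuous_sum fun n _ => ?_)
    have h2 : LowerSemicontinuous fun f : WeakDual ℝ E => tm (F n) (x n) (WeakDual.toStrongDual f) := by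
      refine (lsc_aux (F n)).add ?_
      exact ((WeakDual.eval_continuous (x n)).pow 2).lowerSemicontinuous
    exact (continuous_const.mul continuous_id : Continuous fun r : ℝ => (1/2 : ℝ)^n * r).comp_lowerSemicontinuous
      h2 (fun a b hab => mul_le_mul_of_nonneg_left hab (by positivity))
  intro f y hy
  have ht := ((pen_summable F x hx (WeakDual.toStrongDual f)).hasSum.tendsto_sum_nat).const_add
    (‖WeakDual.toStrongDual f‖ ^ 2)
  obtain ⟨N, hN⟩ := (ht.eventually (lt_mem_nhds hy)).exists
  filter_upwards [hpart N f y hN] with f' hf'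
  refine lt_of_lt_of_le hf' ?_
  unfold pen
  have := (pen_summable F x hx (WeakDual.toStrongDual f')).sum_le_tsum (Finset.range N)
    (fun n _ => mul_nonneg (by positivity) (tm_nonneg _ _ _))
  linarith

lemma pen_exists_max (F : ℕ → StrongDual ℝ E) (x : ℕ → E) (hx : ∀ n, ‖x n‖ ≤ 1) (z : E) :
    ∃ f0 : StrongDual ℝ E, ∀ f : StrongDual ℝ E, f z - pen F x f ≤ f0 z - pen F x f0 := by
  have hl : LowerSemicontinuous fun f : WeakDual ℝ E =>
      pen F x (WeakDual.toStrongDual f) + (-(f z)) :=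
    (pen_lsc F x hx).add (WeakDual.eval_continuous z).neg.lowerSemicontinuous
  obtain ⟨f0, hf0, hmin⟩ := LowerSemicontinuousOn.exists_isMinOn
    (s := WeakDual.toStrongDual ⁻¹' Metric.closedBall (0 : StrongDual ℝ E) ‖z‖)
    ⟨0, by simp⟩ (WeakDual.isCompact_closedBall 0 ‖z‖) (hl.lowerSemicontinuousOn _)
  have hmin' : ∀ f : StrongDual ℝ E, ‖f‖ ≤ ‖z‖ →
      f z - pen F x f ≤ (WeakDual.toStrongDual f0) z - pen F x (WeakDual.toStrongDual f0) := by
    intro f hf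
    have := hmin (a := StrongDual.toWeakDual f) (by simpa using hf)
    simp only [Set.mem_ofPred_eq] at this
    change pen F x (WeakDual.toStrongDual f0) + -((WeakDual.toStrongDual f0) z) ≤ pen F x f + -(f z) at this
    linarith
  refine ⟨WeakDual.toStrongDual f0, fun f => ?_⟩
  by_cases hf : ‖f‖ ≤ ‖z‖
  · exact hmin' f hf
  · push Not at hf
    have h0 := hmin' 0 (by simp)
    have h1 := pen_le F x hx (0 : StrongDual ℝ E)
    have h2 := pen_ge F x f
    have h3 := (le_abs_self _).trans (f.le_opNorm z)
    simp only [zero_apply, norm_zero] at h0 h1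
    nlinarith [norm_nonneg z]

set_option maxHeartbeats 1000000 in
/-- A space with separable dual carries a convex Fréchet smooth gauge of quadratic growth. -/
theorem exists_smooth_gauge [TopologicalSpace.SeparableSpace (StrongDual ℝ E)] :
    ∃ (H : E → ℝ) (P : E → StrongDual ℝ E),
      (∀ z, ‖z‖ ^ 2 / 20 ≤ H z) ∧ (∀ z, H z ≤ ‖z‖ ^ 2) ∧ (∀ z, ‖P z‖ ≤ ‖z‖) ∧
      (∀ z, HasFDerivAt H (P z) z) ∧ (∀ z y, H z + P z (y - z) ≤ H y) ∧ Continuous P := by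
  set F := TopologicalSpace.denseSeq (StrongDual ℝ E) with hF
  have hdense : DenseRange F := TopologicalSpace.denseRange_denseSeq _
  have hex : ∀ n, ∃ x : E, ‖x‖ ≤ 1 ∧ ‖F n‖ / 2 ≤ |F n x| := by
    intro n
    by_cases h : F n = 0
    · exact ⟨0, by simp, by simp [h]⟩
    · obtain ⟨x, h1, h2⟩ := ContinuousLinearMap.exists_lt_apply_of_lt_opNorm (F n)
        (half_lt_self (norm_pos_iff.2 h))
      exact ⟨x, h1.le, h2.le⟩
  choose x hx hFx using hex
  choose P hP using pen_exists_max F x hx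
  have hPn : ∀ z, ‖P z‖ ≤ ‖z‖ := by
    intro z
    have h0 := hP z 0
    have h1 := pen_le F x hx (0 : StrongDual ℝ E)
    have h2 := pen_ge F x (P z)
    have h3 := (le_abs_self _).trans ((P z).le_opNorm z)
    simp at h0 h1
    by_contra hcon
    push Not at hcon
    nlinarith [norm_nonneg z]
  set H : E → ℝ := fun z => P z z - pen F x (P z) with hH
  have hsub : ∀ z y, H z + P z (y - z) ≤ H y := by
    intro z y
    have := hP y (P z)
    simp only [hH, map_sub]
    linarith
  have hcont : Continuous P := by
    rw [continuous_iff_continuousAt]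
    intro z
    rw [Metric.continuousAt_iff']
    intro ε' hε'
    obtain ⟨ε, hε, hεε⟩ : ∃ ε > 0, 12 * ε < ε' := ⟨ε' / 24, by positivity, by linarith⟩
    obtain ⟨n, hn⟩ := hdense.exists_dist_lt (P z) hε
    rw [dist_eq_norm] at hn
    have hk0 : kerNorm (F n) (P z) ≤ ε := by
      apply kerNorm_le_of _ _ _ hε.le
      intro y hy
      have := (P z - F n).le_opNorm y
      simp only [sub_apply, hy, sub_zero, Real.norm_eq_abs] at this
      nlinarith [norm_nonneg y]
    -- closeness
    have hev : ∀ᶠ y in 𝓝 z, ‖P y - P z‖ * ‖y - z‖ < 2 * ((1/2 : ℝ) ^ n * (ε ^ 2 / 4)) := by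
      have hc : Tendsto (fun y : E => (‖y‖ + ‖z‖) * ‖y - z‖) (𝓝 z) (𝓝 0) := by
        have : Continuous (fun y : E => (‖y‖ + ‖z‖) * ‖y - z‖) := by fun_prop
        simpa using this.tendsto z
      filter_upwards [hc.eventually (gt_mem_nhds (by positivity :
        (0:ℝ) < 2 * ((1/2 : ℝ) ^ n * (ε ^ 2 / 4))))] with y hy
      refine lt_of_le_of_lt ?_ hy
      gcongr
      exact (norm_sub_le _ _).trans (add_le_add (hPn y) (hPn z))
    filter_upwards [hev] with y hy
    rw [dist_eq_norm]
    have hmid := pen_mid F x hx (P y) (P z) n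
    have h1 := hP z ((1/2 : ℝ) • (P y + P z))
    have h2 := hP y (P z)
    have h3 := (le_abs_self _).trans ((P y - P z).le_opNorm (y - z))
    simp only [smul_apply, add_apply, smul_eq_mul,
      sub_apply, map_sub] at h1 h3
    have h4 : (1/2 : ℝ) ^ n * ((kerNorm (F n) (P y) - kerNorm (F n) (P z)) ^ 2 / 4
        + (P y (x n) - P z (x n)) ^ 2 / 4) < (1/2 : ℝ) ^ n * (ε ^ 2 / 4) := by
      linarith
    have h5 := lt_of_mul_lt_mul_left h4 (by positivity)
    have h6 : |kerNorm (F n) (P y) - kerNorm (F n) (P z)| ≤ ε :=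
      abs_le_of_sq_le_sq (by nlinarith [sq_nonneg (P y (x n) - P z (x n))]) hε.le
    have h7 : |P y (x n) - P z (x n)| ≤ ε :=
      abs_le_of_sq_le_sq (by nlinarith [sq_nonneg (kerNorm (F n) (P y) - kerNorm (F n) (P z))]) hε.le
    have h8 : kerNorm (F n) (P y) ≤ 2 * ε := by linarith [(abs_le.1 h6).2]
    have h9 : ∀ t, F n t = 0 → |(P y - P z) t| ≤ 3 * ε * ‖t‖ := by
      intro t ht
      have a1 := kerNorm_apply (F n) (P y) t ht
      have a2 := kerNorm_apply (F n) (P z) t ht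
      have a3 := abs_sub (P y t) (P z t)
      simp only [sub_apply]
      nlinarith [norm_nonneg t]
    refine lt_of_le_of_lt (ContinuousLinearMap.opNorm_le_bound _ (M := 12 * ε) (by positivity) ?_) hεε
    intro t
    rw [Real.norm_eq_abs]
    by_cases hFn : F n = 0
    · refine (h9 t (by simp [hFn])).trans ?_
      nlinarith [norm_nonneg t]
    · have hpos : 0 < |F n (x n)| := lt_of_lt_of_le (by have := norm_pos_iff.2 hFn; positivity) (hFx n)
      have hne : F n (x n) ≠ 0 := abs_pos.1 hpos
      set c := F n t / F n (x n) with hc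
      have hcb : |c| ≤ 2 * ‖t‖ := by
        rw [hc, abs_div, div_le_iff₀ hpos]
        have := (F n).le_opNorm t
        rw [Real.norm_eq_abs] at this
        nlinarith [norm_nonneg t, hFx n]
      have hker : F n (t - c • x n) = 0 := by
        simp [hc, hne]
      have b1 := h9 _ hker
      have b2 : ‖t - c • x n‖ ≤ 3 * ‖t‖ := by
        refine (norm_sub_le _ _).trans ?_
        rw [norm_smul, Real.norm_eq_abs]
        nlinarith [hx n, norm_nonneg (x n), abs_nonneg c, norm_nonneg t]
      have b3 : (P y - P z) t = (P y - P z) (t - c • x n) + c * (P y (x n) - P z (x n)) := by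
        simp; ring
      have b5 := abs_add_le ((P y - P z) (t - c • x n)) (c * (P y (x n) - P z (x n)))
      rw [← b3, abs_mul] at b5
      have b6 : 3 * ε * ‖t - c • x n‖ ≤ 3 * ε * (3 * ‖t‖) := by gcongr
      have b4 : |c| * |P y (x n) - P z (x n)| ≤ 2 * ‖t‖ * ε := by gcongr
      have b7 : 0 ≤ ε * ‖t‖ := by positivity
      linarith
  refine ⟨H, P, ?_, ?_, hPn, ?_, hsub, hcont⟩
  · intro z
    obtain ⟨g, hg1, hg2⟩ := exists_dual_vector'' ℝ z
    have h1 := hP z ((‖z‖ / 10) • g)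
    have h2 := pen_le F x hx ((‖z‖ / 10) • g)
    have h3 : ‖(‖z‖ / 10) • g‖ ≤ ‖z‖ / 10 := by
      rw [norm_smul, Real.norm_of_nonneg (by positivity)]
      nlinarith [norm_nonneg z]
    have h4 : ‖(‖z‖ / 10) • g‖ ^ 2 ≤ (‖z‖ / 10) ^ 2 := by gcongr
    simp only [smul_apply, hg2, smul_eq_mul] at h1
    simp only [hH]
    simp only [RCLike.ofReal_real_eq_id, id] at h1
    nlinarith
  · intro z
    have h2 := pen_ge F x (P z)
    have h3 := (le_abs_self _).trans ((P z).le_opNorm z)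
    simp only [hH]
    nlinarith [norm_nonneg z, norm_nonneg (P z), hPn z, sq_nonneg (‖P z‖)]
  · intro z
    rw [hasFDerivAt_iff_isLittleO, Asymptotics.isLittleO_iff]
    intro c hc
    filter_upwards [(Metric.continuousAt_iff'.1 hcont.continuousAt) c hc] with y hy
    rw [dist_eq_norm] at hy
    have h1 := hsub z y
    have h2 := hsub y z
    have h3 := (le_abs_self _).trans ((P y - P z).le_opNorm (y - z))
    have h4 : P y (z - y) = - P y (y - z) := by rw [← map_neg]; simp
    rw [sub_apply] at h3
    rw [Real.norm_eq_abs, abs_of_nonneg (by linarith)]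
    have h5 : ‖P y - P z‖ * ‖y - z‖ ≤ c * ‖y - z‖ := by gcongr
    linarith
end
end ThreePointsAux

noncomputable section ThreePointsAux2

/-- sequence of (function, point) pairs used in the smooth variational principle -/
def vpSeq {E : Type*} [NormedAddCommGroup E] (H : E → ℝ) (μ : ℕ → ℝ)
    (pick : ℕ → (E → ℝ) → E → E) (F : E → ℝ) (x0 : E) : ℕ → (E → ℝ) × E
  | 0 => (F, x0)
  | (n+1) =>
    let G' : E → ℝ := fun z => (vpSeq H μ pick F x0 n).1 z + μ n * H (z - (vpSeq H μ pick F x0 n).2)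
    (G', pick n G' (vpSeq H μ pick F x0 n).2)

section
variable {E : Type*} [NormedAddCommGroup E] [NormedSpace ℝ E]

/-- Abstract smooth variational principle: sequence level. -/
lemma vp_seq (H : E → ℝ) (hH0 : ∀ z, 0 ≤ H z) (D : Set E) (F : E → ℝ) (m : ℝ)
    (hm : ∀ x ∈ D, m ≤ F x) (x0 : E) (hx0 : x0 ∈ D) (μ ε : ℕ → ℝ) (hμ : ∀ n, 0 < μ n)
    (hε : ∀ n, 0 < ε n) :
    ∃ (G : ℕ → E → ℝ) (x : ℕ → E), (∀ n, x n ∈ D) ∧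
      (∀ n z, G n z = F z + ∑ j ∈ Finset.range n, μ j * H (z - x j)) ∧
      (∀ n, G (n+1) (x (n+1)) ≤ G (n+1) (x n)) ∧
      (∀ n, ∀ z ∈ D, G (n+1) (x (n+1)) ≤ G (n+1) z + ε n) := by
  have hpick : ∀ (n : ℕ) (G : E → ℝ) (y : E), ∃ y' : E, y ∈ D → (∀ z ∈ D, m ≤ G z) →
      y' ∈ D ∧ G y' ≤ G y ∧ ∀ z ∈ D, G y' ≤ G z + ε n := by
    intro n G y
    by_cases h : y ∈ D ∧ (∀ z ∈ D, m ≤ G z)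
    · obtain ⟨hy, hG⟩ := h
      have hne : (G '' D).Nonempty := ⟨_, y, hy, rfl⟩
      have hbd : BddBelow (G '' D) := ⟨m, by rintro _ ⟨z, hz, rfl⟩; exact hG z hz⟩
      obtain ⟨_, ⟨y1, hy1, rfl⟩, hlt⟩ := Real.lt_sInf_add_pos hne (hε n)
      have h1 : ∀ z ∈ D, G y1 ≤ G z + ε n := fun z hz => by
        have := csInf_le hbd ⟨z, hz, rfl⟩
        linarith
      by_cases hc : G y1 ≤ G y
      · exact ⟨y1, fun _ _ => ⟨hy1, hc, h1⟩⟩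
      · push Not at hc
        exact ⟨y, fun _ _ => ⟨hy, le_rfl, fun z hz => hc.le.trans (h1 z hz)⟩⟩
    · exact ⟨y, fun h1 h2 => absurd ⟨h1, h2⟩ h⟩
  choose pick hpick using hpick
  set s := vpSeq H μ pick F x0 with hs
  have hs0 : s 0 = (F, x0) := rfl
  have hs1 : ∀ n, (s (n+1)).1 = fun z => (s n).1 z + μ n * H (z - (s n).2) := fun n => rfl
  have hs2 : ∀ n, (s (n+1)).2 = pick n (s (n+1)).1 (s n).2 := fun n => rfl
  have hG : ∀ n, ∀ z ∈ D, m ≤ (s n).1 z := by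
    intro n
    induction n with
    | zero => exact hm
    | succ n ih =>
      intro z hz
      rw [hs1]
      have := ih z hz
      have := mul_nonneg (hμ n).le (hH0 (z - (s n).2))
      simp only
      linarith
  have hxD : ∀ n, (s n).2 ∈ D := by
    intro n
    induction n with
    | zero => exact hx0
    | succ n ih => rw [hs2]; exact (hpick n _ _ ih (hG (n+1))).1
  refine ⟨fun n => (s n).1, fun n => (s n).2, hxD, ?_, ?_, ?_⟩
  · intro n z
    induction n with
    | zero => simp [hs0]
    | succ n ih =>
      simp only at ih ⊢
      rw [hs1, Finset.sum_range_succ, ← add_assoc, ← ih]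
  · intro n
    have := (hpick n _ _ (hxD n) (hG (n+1))).2.1
    rwa [← hs2] at this
  · intro n
    have := (hpick n _ _ (hxD n) (hG (n+1))).2.2
    rwa [← hs2] at this

set_option maxHeartbeats 1000000 in
/-- Smooth variational principle. -/
theorem smooth_vp [CompleteSpace E] (H : E → ℝ) (P : E → StrongDual ℝ E)
    (hHl : ∀ z, ‖z‖ ^ 2 / 20 ≤ H z) (hHu : ∀ z, H z ≤ ‖z‖ ^ 2) (hPn : ∀ z, ‖P z‖ ≤ ‖z‖)
    (hHd : ∀ z, HasFDerivAt H (P z) z)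
    (D : Set E) (F : E → ℝ) (m : ℝ) (hm : ∀ x ∈ D, m ≤ F x) (x0 : E) (hx0 : x0 ∈ D)
    (hcl : IsClosed {q : E × ℝ | q.1 ∈ D ∧ F q.1 ≤ q.2}) (R : ℝ) (hR : ∀ x ∈ D, ‖x‖ ≤ R)
    (η : ℝ) (hη : 0 < η) :
    ∃ xb ∈ D, ∃ (g : E → ℝ) (g' : StrongDual ℝ E), HasFDerivAt g g' xb ∧ ‖g'‖ ≤ η ∧
      (∀ x ∈ D, 0 ≤ g x ∧ g x ≤ η) ∧ ∀ x ∈ D, F xb + g xb ≤ F x + g x := by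
  have hH0 : ∀ z, 0 ≤ H z := fun z => le_trans (by positivity) (hHl z)
  have hHz : H 0 = 0 := le_antisymm (by simpa using hHu 0) (hH0 0)
  have hHc : Continuous H := continuous_iff_continuousAt.2 fun z => (hHd z).continuousAt
  have hR0 : 0 ≤ R := (norm_nonneg _).trans (hR x0 hx0)
  set B : ℝ := (2 * R + 1) ^ 2 with hB
  have hB1 : 1 ≤ B := by rw [hB]; nlinarith
  have hB2 : 2 * R + 1 ≤ B := by rw [hB]; nlinarith
  set μ0 : ℝ := η / (2 * B) with hμ0
  have hμpos0 : 0 < μ0 := by positivity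
  have hμB : μ0 * B * 2 = η := by rw [hμ0]; field_simp
  set μ : ℕ → ℝ := fun n => (1/2 : ℝ) ^ n * μ0 with hμ
  have hμp : ∀ n, 0 < μ n := fun n => by simp only [hμ]; positivity
  obtain ⟨G, x, hxD, hG, hdec, hmin⟩ := vp_seq H hH0 D F m hm x0 hx0 μ
    (fun n => μ (n+1) * (1/2 : ℝ)^(n+1)) hμp (fun n => mul_pos (hμp _) (by positivity))
  have hGs : ∀ n z, G (n+1) z = G n z + μ n * H (z - x n) := by
    intro n z
    rw [hG, hG, Finset.sum_range_succ]; ring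
  have hGx : ∀ n, G (n+1) (x n) = G n (x n) := by
    intro n; rw [hGs]; simp [hHz]
  have hGmono : ∀ z, Monotone fun n => G n z := fun z => monotone_nat_of_le_succ fun n => by
    rw [hGs]; have := mul_nonneg (hμp n).le (hH0 (z - x n)); linarith
  have hval : Antitone fun n => G n (x n) := antitone_nat_of_succ_le fun n => by
    rw [← hGx n]; exact hdec n
  have hS : ∀ n j, n ≤ j → G (n+1) (x j) ≤ G n (x n) := by
    intro n j hj
    calc G (n+1) (x j) ≤ G (j+1) (x j) := hGmono _ (by omega)
      _ = G j (x j) := hGx j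
      _ ≤ _ := hval hj
  have hdist : ∀ n j, n + 1 ≤ j → ‖x j - x (n+1)‖ ^ 2 ≤ 20 * (1/2 : ℝ)^(n+1) := by
    intro n j hj
    have h1 := hS (n+1) j hj
    have h2 := hmin n (x j) (hxD j)
    rw [hGs] at h1
    have h3 : μ (n+1) * H (x j - x (n+1)) ≤ μ (n+1) * (1/2 : ℝ)^(n+1) := by linarith
    have h4 := le_of_mul_le_mul_left h3 (hμp _)
    have := hHl (x j - x (n+1))
    linarith
  have hcau : CauchySeq x := by
    rw [Metric.cauchySeq_iff']
    intro e he
    have ht : Tendsto (fun n : ℕ => 20 * (1/2 : ℝ)^(n+1)) atTop (𝓝 0) := by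
      have := ((tendsto_pow_atTop_nhds_zero_of_lt_one (by norm_num) (by norm_num :
        (1/2 : ℝ) < 1)).comp (tendsto_add_atTop_nat 1)).const_mul 20
      simpa using this
    obtain ⟨n, hn⟩ := (ht.eventually (gt_mem_nhds (by positivity : 0 < e ^ 2))).exists
    refine ⟨n+1, fun j hj => ?_⟩
    rw [dist_eq_norm]
    exact lt_of_pow_lt_pow_left₀ 2 he.le (lt_of_le_of_lt (hdist n j hj) hn)
  obtain ⟨xb, hxb⟩ := cauchySeq_tendsto_of_complete hcau
  have hlim : ∀ n, xb ∈ D ∧ G (n+1) xb ≤ G n (x n) := by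
    intro n
    have hcont : Continuous fun z => ∑ j ∈ Finset.range (n+1), μ j * H (z - x j) :=
      continuous_finsetSum _ fun j _ => continuous_const.mul (hHc.comp (continuous_id.sub continuous_const))
    have hclS : IsClosed {z : E | z ∈ D ∧ F z ≤ G n (x n) - ∑ j ∈ Finset.range (n+1), μ j * H (z - x j)} :=
      hcl.preimage (continuous_id.prodMk (continuous_const.sub hcont))
    have hmem : xb ∈ {z : E | z ∈ D ∧ F z ≤ G n (x n) - ∑ j ∈ Finset.range (n+1), μ j * H (z - x j)} := by
      refine hclS.mem_of_tendsto hxb ?_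
      filter_upwards [eventually_ge_atTop n] with j hj
      refine ⟨hxD j, ?_⟩
      have := hS n j hj
      rw [hG] at this
      linarith
    refine ⟨hmem.1, ?_⟩
    have := hmem.2
    rw [hG]; linarith
  have hxbD := (hlim 0).1
  have hterm : ∀ z, ‖z‖ ≤ R + 1 → ∀ j, μ j * H (z - x j) ≤ (1/2 : ℝ)^j * (μ0 * B) := by
    intro z hz j
    have h1 : ‖z - x j‖ ≤ 2 * R + 1 := (norm_sub_le _ _).trans (by linarith [hR _ (hxD j)])
    have h2 : H (z - x j) ≤ B := (hHu _).trans (by rw [hB]; gcongr)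
    simp only [hμ]
    rw [mul_assoc]
    gcongr
  have hgeo : Summable fun j : ℕ => (1/2 : ℝ)^j * (μ0 * B) := summable_geometric_two.mul_right _
  have hsum : ∀ z, ‖z‖ ≤ R + 1 → Summable fun j => μ j * H (z - x j) := fun z hz =>
    Summable.of_nonneg_of_le (fun j => mul_nonneg (hμp j).le (hH0 _)) (hterm z hz) hgeo
  have hgeosum : ∑' j : ℕ, (1/2 : ℝ)^j * (μ0 * B) = η := by
    rw [tsum_mul_right, tsum_geometric_two]; linarith
  have hRD : ∀ z ∈ D, ‖z‖ ≤ R + 1 := fun z hz => by linarith [hR z hz]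
  have hder : ∀ (j : ℕ) (z : E), z ∈ Metric.ball (0 : E) (R+1) → ‖μ j • P (z - x j)‖ ≤ (1/2 : ℝ)^j * (μ0 * B) := by
    intro j z hz
    rw [norm_smul, Real.norm_of_nonneg (hμp j).le]
    have hz' : ‖z‖ ≤ R + 1 := by simpa using (Metric.mem_ball.1 hz).le
    have h1 : ‖z - x j‖ ≤ 2 * R + 1 := (norm_sub_le _ _).trans (by linarith [hR _ (hxD j)])
    have h2 : ‖P (z - x j)‖ ≤ B := ((hPn _).trans h1).trans hB2
    simp only [hμ]
    rw [mul_assoc]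
    gcongr
  have hxball : xb ∈ Metric.ball (0 : E) (R+1) := by
    rw [mem_ball_zero_iff]; linarith [hR _ hxbD]
  refine ⟨xb, hxbD, fun z => ∑' j, μ j * H (z - x j), ∑' j, μ j • P (xb - x j), ?_, ?_, ?_, ?_⟩
  · refine hasFDerivAt_tsum_of_isPreconnected (f := fun j z => μ j * H (z - x j))
      (f' := fun j z => μ j • P (z - x j)) hgeo Metric.isOpen_ball
      (convex_ball (0:E) (R+1)).isPreconnected ?_ hder hxball (hsum xb (hRD _ hxbD)) hxball
    intro j z _
    have hd : HasFDerivAt (fun z => H (z - x j)) (P (z - x j)) z := by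
      have := (hHd (z - x j)).comp z ((hasFDerivAt_id z).sub_const (x j))
      simpa [Function.comp_def] using this
    exact hd.const_mul (μ j)
  · rw [← hgeosum]
    exact tsum_of_norm_bounded hgeo.hasSum fun j => hder j xb hxball
  · intro z hz
    refine ⟨tsum_nonneg fun j => mul_nonneg (hμp j).le (hH0 _), ?_⟩
    rw [← hgeosum]
    exact (hsum z (hRD z hz)).tsum_le_tsum (hterm z (hRD z hz)) hgeo
  · intro z hz
    have hlimz : Tendsto (fun n => G n z) atTop (𝓝 (F z + ∑' j, μ j * H (z - x j))) := by
      simp only [hG]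
      exact ((hsum z (hRD z hz)).hasSum.tendsto_sum_nat).const_add _
    have hlimb : Tendsto (fun n => G n xb) atTop (𝓝 (F xb + ∑' j, μ j * H (xb - x j))) := by
      simp only [hG]
      exact ((hsum xb (hRD xb hxbD)).hasSum.tendsto_sum_nat).const_add _
    have he : Tendsto (fun n => μ (n+1) * (1/2 : ℝ)^(n+1)) atTop (𝓝 0) := by
      have h0 := (tendsto_pow_atTop_nhds_zero_of_lt_one (by norm_num) (by norm_num :
        (1/2 : ℝ) < 1)).comp (tendsto_add_atTop_nat 1)
      have := (h0.mul_const μ0).mul h0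
      simpa [hμ, Function.comp_def] using this
    have hr := (hlimz.comp (tendsto_add_atTop_nat 1)).add he
    rw [add_zero] at hr
    refine le_of_tendsto_of_tendsto (hlimb.comp (tendsto_add_atTop_nat 2)) hr
      (Eventually.of_forall fun n => ?_)
    have h1 := (hlim (n+1)).2
    have h2 := hmin n z hz
    simp only [Function.comp]
    exact h1.trans h2
end
end ThreePointsAux2

noncomputable section ThreePointsAux3
section
variable {E : Type*} [NormedAddCommGroup E] [NormedSpace ℝ E]

lemma isCompact_seg (u v : E) : IsCompact (segment ℝ u v) := by
  rw [segment_eq_image_lineMap]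
  exact isCompact_Icc.image AffineMap.lineMap_continuous

lemma bdd_near (φ : E → EReal) (hnobot : ∀ x, φ x ≠ ⊥) (hlsc : LowerSemicontinuous φ)
    (K : Set E) (hK : IsCompact K) :
    ∃ (δ m : ℝ), 0 < δ ∧ ∀ x ∈ Metric.cthickening δ K, (m : EReal) < φ x := by
  obtain ⟨n, hn⟩ := hK.elim_directed_cover (fun n : ℕ => φ ⁻¹' Set.Ioi (((-(n:ℝ)) : ℝ) : EReal))
    (fun n => hlsc.isOpen_preimage _) (by
      intro x _
      rw [Set.mem_iUnion]
      obtain ⟨r, hr⟩ := EReal.lt_iff_exists_real_btwn.1 (bot_lt_iff_ne_bot.2 (hnobot x))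
      obtain ⟨n, hn⟩ := exists_nat_gt (-r)
      refine ⟨n, lt_of_le_of_lt ?_ hr.2⟩
      exact_mod_cast (by linarith : -(n:ℝ) ≤ r))
    (directed_of_isDirected_le (by
      intro a b hab x hx
      change (((-(a:ℝ)) : ℝ) : EReal) < φ x at hx
      change (((-(b:ℝ)) : ℝ) : EReal) < φ x
      refine lt_of_le_of_lt ?_ hx
      have : (a:ℝ) ≤ b := by exact_mod_cast hab
      exact_mod_cast (by linarith : -(b:ℝ) ≤ -(a:ℝ))))
  obtain ⟨δ, hδ, hsub⟩ := hK.exists_cthickening_subset_open (hlsc.isOpen_preimage _) hn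
  exact ⟨δ, _, hδ, fun x hx => hsub hx⟩

set_option maxHeartbeats 2000000 in
theorem three_points_sep [CompleteSpace E] [TopologicalSpace.SeparableSpace (StrongDual ℝ E)]
    (φ : E → EReal) (hnobot : ∀ x, φ x ≠ ⊥) (hlsc : LowerSemicontinuous φ)
    (u v w : E) (hv : v ∈ segment ℝ u w) (hφ : φ u < φ v) (l : ℝ) (hl : 0 < l) :
    ∃ (xb : E) (xbs : E →L[ℝ] ℝ), φ xb ≠ ⊤ ∧ xbs ∈ FrechetSubdiff φ xb ∧
      (∃ y ∈ segment ℝ u v, ‖xb - y‖ < l) ∧ 0 < xbs (w - xb) := by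
  obtain ⟨H, P, hHl, hHu, hPn, hHd, hsub, hPc⟩ := exists_smooth_gauge (E := E)
  have hH0 : ∀ z, 0 ≤ H z := fun z => le_trans (by positivity) (hHl z)
  have hHz : H 0 = 0 := le_antisymm (by simpa using hHu 0) (hH0 0)
  have hHc : Continuous H := continuous_iff_continuousAt.2 fun z => (hHd z).continuousAt
  have huv : u ≠ v := by rintro rfl; exact lt_irrefl _ hφ
  -- geometry of w
  obtain ⟨β, hβ, hw⟩ : ∃ β : ℝ, 0 ≤ β ∧ w - v = β • (v - u) := by
    obtain ⟨a, b, ha, hb, hab, rfl⟩ := hv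
    have hb0 : b ≠ 0 := by
      rintro rfl
      apply huv
      have : a = 1 := by linarith
      simp [this]
    refine ⟨a / b, by positivity, ?_⟩
    have ha' : a = 1 - b := by linarith
    have e : (1 - b) • u + b • w - u = b • (w - u) := by
      simp only [smul_sub, sub_smul, one_smul]; abel
    rw [ha', e, smul_smul, div_mul_cancel₀ _ hb0]
    simp only [smul_sub, sub_smul, one_smul]; abel
  -- real values
  have hφu : φ u ≠ ⊤ := ne_top_of_lt hφ
  set U : ℝ := (φ u).toReal with hU
  have hUe : (U : EReal) = φ u := EReal.coe_toReal hφu (hnobot u)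
  obtain ⟨r, hr1, hr2⟩ := EReal.lt_iff_exists_real_btwn.1 hφ
  rw [← hUe] at hr1
  have hUr : U < r := by exact_mod_cast hr1
  obtain ⟨δ, m, hδ, hm⟩ := bdd_near φ hnobot hlsc _ (isCompact_seg u v)
  obtain ⟨ρ0, hρ0, hball⟩ := Metric.eventually_nhds_iff.1 (hlsc v r hr2)
  obtain ⟨ρ, hρ, hρδ, hρl, hρρ⟩ : ∃ ρ : ℝ, 0 < ρ ∧ ρ ≤ δ ∧ ρ ≤ l ∧ 2 * ρ ≤ ρ0 := by
    refine ⟨min (min δ l) (ρ0 / 2), by positivity, ?_, ?_, ?_⟩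
    · exact (min_le_left _ _).trans (min_le_left _ _)
    · exact (min_le_left _ _).trans (min_le_right _ _)
    · have := min_le_right (min δ l) (ρ0 / 2); linarith
  set s : ℝ := (r - U) / 2 with hs
  have hs0 : 0 < s := by rw [hs]; linarith
  set k : ℝ := (|U| + |m| + 2 * s + 1) / (ρ ^ 2 / 20) with hk
  have hk0 : 0 < k := by positivity
  have hkρ : k * (ρ ^ 2 / 20) = |U| + |m| + 2 * s + 1 := by
    rw [hk]; field_simp
  set γ : ℝ → E := fun t => u + t • (v - u) with hγ
  have hγc : Continuous γ := by rw [hγ]; fun_prop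
  have hγseg : ∀ t ∈ Set.Icc (0:ℝ) 1, γ t ∈ segment ℝ u v := by
    intro t ht
    rw [segment_eq_image']
    exact ⟨t, ht, rfl⟩
  set q : E → ℝ → ℝ := fun x t => k * H (x - γ t) - s * t with hq
  have hqc : Continuous ↿q := by
    have h1 : Continuous fun p : E × ℝ => k * H (p.1 - γ p.2) - s * p.2 := by fun_prop
    exact h1
  have hIc : IsCompact (Set.Icc (0:ℝ) 1) := isCompact_Icc
  set f : E → ℝ := fun x => sInf (q x '' Set.Icc 0 1) with hf
  have hfc : Continuous f := hIc.continuous_sInf hqc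
  have hqx : ∀ x, Continuous (q x) := fun x => hqc.comp (continuous_const.prodMk continuous_id)
  have hfle : ∀ x, ∀ t ∈ Set.Icc (0:ℝ) 1, f x ≤ q x t := fun x t ht =>
    csInf_le (hIc.image (hqx x)).bddBelow ⟨t, ht, rfl⟩
  have hfex : ∀ x, ∃ t ∈ Set.Icc (0:ℝ) 1, f x = q x t := by
    intro x
    obtain ⟨t, ht, h⟩ := (hIc.image (hqx x)).sInf_mem ⟨_, 0, by simp, rfl⟩
    exact ⟨t, ht, h.symm⟩
  set N := Metric.cthickening δ (segment ℝ u v) with hN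
  set D : Set E := {x | x ∈ N ∧ φ x ≠ ⊤} with hD
  set F : E → ℝ := fun x => (φ x).toReal + f x with hF
  have hcoe : ∀ x, φ x ≠ ⊤ → (((φ x).toReal : ℝ) : EReal) = φ x := fun x hx =>
    EReal.coe_toReal hx (hnobot x)
  have hmr : ∀ x ∈ D, m < (φ x).toReal := by
    intro x hx
    have := hm x hx.1
    rw [← hcoe x hx.2] at this
    exact_mod_cast this
  have hfge : ∀ x, -s ≤ f x := by
    intro x
    obtain ⟨t, ht, h⟩ := hfex x
    rw [h]
    have := mul_nonneg hk0.le (hH0 (x - γ t))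
    simp only [hq]
    nlinarith [ht.2]
  have husg : u ∈ segment ℝ u v := left_mem_segment ℝ u v
  have huD : u ∈ D := ⟨Metric.self_subset_cthickening _ husg, hφu⟩
  have hcl : IsClosed {p : E × ℝ | p.1 ∈ D ∧ F p.1 ≤ p.2} := by
    have he : {p : E × ℝ | p.1 ∈ D ∧ F p.1 ≤ p.2} =
        (Prod.fst ⁻¹' N) ∩ ((fun p : E × ℝ => (p.1, ((p.2 - f p.1 : ℝ) : EReal))) ⁻¹'
          {p : E × EReal | φ p.1 ≤ p.2}) := by
      ext ⟨x, c⟩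
      simp only [hD, hF, Set.mem_ofPred_eq, Set.mem_inter_iff, Set.mem_preimage]
      constructor
      · rintro ⟨⟨h1, h2⟩, h3⟩
        refine ⟨h1, ?_⟩
        rw [← hcoe x h2]
        exact_mod_cast (by linarith : (φ x).toReal ≤ c - f x)
      · rintro ⟨h1, h2⟩
        have h3 : φ x ≠ ⊤ := ne_top_of_le_ne_top (EReal.coe_ne_top _) h2
        refine ⟨⟨h1, h3⟩, ?_⟩
        rw [← hcoe x h3] at h2
        have : (φ x).toReal ≤ c - f x := by exact_mod_cast h2
        linarith
    rw [he]
    refine (Metric.isClosed_cthickening.preimage continuous_fst).inter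
      (hlsc.isClosed_epigraph.preimage ?_)
    exact continuous_fst.prodMk (continuous_coe_real_ereal.comp
      (continuous_snd.sub (hfc.comp continuous_fst)))
  obtain ⟨R, hR⟩ : ∃ R, ∀ x ∈ D, ‖x‖ ≤ R := by
    obtain ⟨R, hR⟩ := ((isCompact_seg u v).isBounded.cthickening (δ := δ)).exists_norm_le
    exact ⟨R, fun x hx => hR x hx.1⟩
  have hR0 : 0 ≤ R := (norm_nonneg _).trans (hR u huD)
  have hvu : 0 < ‖v - u‖ := norm_pos_iff.2 (sub_ne_zero.2 huv.symm)
  set C : ℝ := (‖w‖ + R + 1) * ‖v - u‖ with hC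
  have hCp : 0 < C := by positivity
  set η : ℝ := min (s / 2) (ρ * s / (2 * C)) with hη
  have hηp : 0 < η := by positivity
  have hηs : η ≤ s / 2 := min_le_left _ _
  have hηC : η * C < ρ * s := by
    have h1 : η ≤ ρ * s / (2 * C) := min_le_right _ _
    have h2 : η * C ≤ ρ * s / (2 * C) * C := by gcongr
    have h3 : ρ * s / (2 * C) * C = ρ * s / 2 := by field_simp
    have h4 : 0 < ρ * s := by positivity
    linarith
  obtain ⟨xb, hxb, g, g', hg, hg', hgb, hmin⟩ := smooth_vp H P hHl hHu hPn hHd D F (m - s)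
    (fun x hx => by simp only [hF]; linarith [hmr x hx, hfge x]) u huD hcl R hR η hηp
  obtain ⟨t, ht, hft⟩ := hfex xb
  have hFu : F u ≤ U := by
    have h1 := hfle u 0 (by simp)
    simp only [hq, hγ] at h1
    simp [hHz] at h1
    simp only [hF]
    linarith
  have hFxb : F xb ≤ U + s / 2 := by
    have := hmin u huD
    linarith [(hgb u huD).2, (hgb xb hxb).1]
  have hFt : F xb = (φ xb).toReal + (k * H (xb - γ t) - s * t) := by simp only [hF, hft, hq]
  set z := xb - γ t with hz
  -- closeness to the segment
  have hzρ : ‖z‖ < ρ := by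
    by_contra hcon
    push Not at hcon
    have h1 : ρ ^ 2 / 20 ≤ H z := le_trans (by gcongr) (hHl z)
    have h2 : k * (ρ ^ 2 / 20) ≤ k * H z := by gcongr
    have h3 := hmr xb hxb
    have h4 := neg_abs_le m
    have h5 := le_abs_self U
    nlinarith [ht.2]
  have htρ : ρ ≤ (1 - t) * ‖v - u‖ := by
    by_contra hcon
    push Not at hcon
    have e1 : xb - v = z - (1 - t) • (v - u) := by
      simp only [hz, hγ, sub_smul, one_smul]; abel
    have h1 : ‖xb - v‖ < ρ0 := by
      rw [e1]
      refine lt_of_le_of_lt (norm_sub_le _ _) ?_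
      rw [norm_smul, Real.norm_of_nonneg (by linarith [ht.2])]
      linarith
    have h2 := hball (y := xb) (by rw [dist_eq_norm]; exact h1)
    change (r : EReal) < φ xb at h2
    rw [← hcoe xb hxb.2] at h2
    have h3 : r < (φ xb).toReal := by exact_mod_cast h2
    have h4 := mul_nonneg hk0.le (hH0 z)
    nlinarith [ht.2]
  have ht1 : t < 1 := by
    by_contra hcon
    push Not at hcon
    nlinarith
  -- stationarity in t
  have hstat : s ≤ -(k * P z (v - u)) := by
    have hlim : Tendsto (fun τ : ℝ => -(k * P (xb - γ τ) (v - u))) (𝓝[>] t) (𝓝 (-(k * P z (v - u)))) := by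
      have : Continuous fun τ : ℝ => -(k * P (xb - γ τ) (v - u)) := by fun_prop
      exact (this.tendsto t).mono_left nhdsWithin_le_nhds
    refine ge_of_tendsto hlim ?_
    filter_upwards [Ioo_mem_nhdsGT ht1] with τ hτ
    have h1 := hfle xb τ ⟨ht.1.trans hτ.1.le, hτ.2.le⟩
    rw [hft] at h1
    simp only [hq] at h1
    have h2 := hsub (xb - γ τ) (xb - γ t)
    have e : xb - γ t - (xb - γ τ) = (τ - t) • (v - u) := by
      simp only [hγ, sub_smul]; abel
    rw [e, map_smul, smul_eq_mul] at h2
    have h3 : 0 < τ - t := by linarith [hτ.1]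
    have h4 := mul_le_mul_of_nonneg_left h2 hk0.le
    have h5 : (τ - t) * s ≤ (τ - t) * (-(k * P (xb - γ τ) (v - u))) := by
      linarith
    exact le_of_mul_le_mul_left h5 h3
  refine ⟨xb, -(k • P z) - g', hxb.2, ⟨hxb.2, ?_⟩, ⟨γ t, hγseg t ht, lt_of_lt_of_le hzρ hρl⟩, ?_⟩
  · intro e he
    have hΨ : HasFDerivAt (fun x => k * H (x - γ t) + g x) (k • P z + g') xb := by
      have hd : HasFDerivAt (fun x => H (x - γ t)) (P z) xb := by
        have := (hHd z).comp xb ((hasFDerivAt_id xb).sub_const (γ t))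
        simpa [Function.comp_def] using this
      exact (hd.const_mul k).add hg
    have hΨ' := (Asymptotics.isLittleO_iff.1 (hasFDerivAt_iff_isLittleO.1 hΨ)) he
    have hnear : ∀ᶠ x in 𝓝 xb, ‖x - γ t‖ < ρ := by
      have hc : Continuous fun x : E => ‖x - γ t‖ := by fun_prop
      exact (hc.tendsto xb).eventually (gt_mem_nhds hzρ)
    filter_upwards [hΨ', hnear] with x hx1 hx2
    by_cases hxt : φ x = ⊤
    · rw [hxt]; exact le_top
    have hxD : x ∈ D := by
      refine ⟨?_, hxt⟩
      exact Metric.mem_cthickening_of_dist_le x (γ t) δ _ (hγseg t ht)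
        (by rw [dist_eq_norm]; linarith)
    have h1 := hmin x hxD
    have h2 := hfle x t ht
    rw [hFt] at h1
    simp only [hF, hq] at h1 h2
    have h3 := (le_abs_self _).trans hx1
    rw [← hcoe x hxt, ← hcoe xb hxb.2]
    have h4 : (φ xb).toReal + (-(k • P z) - g') (x - xb) - e * ‖x - xb‖ ≤ (φ x).toReal := by
      simp only [sub_apply, neg_apply, add_apply] at h3 ⊢
      linarith
    exact_mod_cast h4
  · have e1 : w - xb = (1 - t + β) • (v - u) - z := by
      have : w = v + β • (v - u) := by rw [← hw]; abel
      rw [this]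
      simp only [hz, hγ, sub_smul, add_smul, one_smul]; abel
    have h1 : 0 ≤ P z z := by
      have := hsub z 0
      rw [zero_sub, map_neg, hHz] at this
      linarith [hH0 z]
    have h2 := (le_abs_self _).trans (g'.le_opNorm (w - xb))
    have h3 : ‖g'‖ * ‖w - xb‖ ≤ η * (‖w‖ + R + 1) := by
      gcongr
      refine (norm_sub_le _ _).trans ?_
      linarith [hR xb hxb]
    have h4 : (1 - t) * s ≤ (1 - t + β) * (-(k * P z (v - u))) := by
      have a1 : 0 ≤ 1 - t := by linarith
      have a2 : (1 - t + β) * s ≤ (1 - t + β) * (-(k * P z (v - u))) := by gcongr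
      nlinarith
    have h5 : η * (‖w‖ + R + 1) < (1 - t) * s := by
      have a1 : η * (‖w‖ + R + 1) * ‖v - u‖ < (1 - t) * s * ‖v - u‖ := by
        have : ρ * s ≤ (1 - t) * ‖v - u‖ * s := by gcongr
        rw [hC] at hηC
        linarith
      exact lt_of_mul_lt_mul_right a1 hvu.le
    have h6 : (-(k • P z) - g') (w - xb) = (1 - t + β) * (-(k * P z (v - u))) + k * P z z - g' (w - xb) := by
      rw [sub_apply, neg_apply, smul_apply]
      conv_lhs => rw [show P z (w - xb) = (1 - t + β) * P z (v - u) - P z z by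
        rw [e1, map_sub, map_smul, smul_eq_mul]]
      simp only [smul_eq_mul]
      ring
    rw [h6]
    have h7 := mul_nonneg hk0.le h1
    linarith
end
end ThreePointsAux3

noncomputable section ThreePointsAux4
section
variable {X : Type*} [NormedAddCommGroup X] [NormedSpace ℝ X]

/-- finite systems of approximate conditions used for the separable reduction -/
def goodTuple (φ : X → EReal) (k : ℕ) (α r s : Fin k → ℝ) (t : ℝ) (d e : X) (z : Fin k → X) : Prop :=
  (∀ i, φ (z i) < (r i : EReal)) ∧ (∀ i, ‖z i - d‖ < s i) ∧ ‖∑ i, α i • z i - e‖ < t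

lemma sep_step (φ : X → EReal) (Z : Submodule ℝ X) (hZ : TopologicalSpace.IsSeparable (Z : Set X)) :
    ∃ Z' : Submodule ℝ X, Z ≤ Z' ∧ TopologicalSpace.IsSeparable (Z' : Set X) ∧
      ∀ (k : ℕ) (α r s : Fin k → ℝ) (t : ℝ) (d e : X), d ∈ Z → e ∈ Z →
        (∃ z, goodTuple φ k α r s t d e z) → ∃ z, goodTuple φ k α r s t d e z ∧ ∀ i, z i ∈ Z' := by
  haveI : TopologicalSpace.SeparableSpace Z := hZ.separableSpace
  haveI : SecondCountableTopology Z := UniformSpace.secondCountable_of_separable Z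
  have key : ∀ k : ℕ, ∃ T : Set (Fin k → X), T.Countable ∧
      ∀ (α r s : Fin k → ℝ) (t : ℝ) (d e : X), d ∈ Z → e ∈ Z →
        (∃ z, goodTuple φ k α r s t d e z) → ∃ z ∈ T, goodTuple φ k α r s t d e z := by
    intro k
    let O : (Fin k → X) → Set ((Fin k → ℝ) × (Fin k → ℝ) × (Fin k → ℝ) × ℝ × Z × Z) :=
      fun z => {p | goodTuple φ k p.1 p.2.1 p.2.2.1 p.2.2.2.1 p.2.2.2.2.1 p.2.2.2.2.2 z}
    have hO : ∀ z, IsOpen (O z) := by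
      intro z
      have h1 : IsOpen {p : (Fin k → ℝ) × (Fin k → ℝ) × (Fin k → ℝ) × ℝ × Z × Z |
          ∀ i, φ (z i) < (p.2.1 i : EReal)} := by
        simp only [Set.ofPred_forall]
        refine isOpen_iInter_of_finite fun i => ?_
        exact isOpen_lt continuous_const (continuous_coe_real_ereal.comp (by fun_prop))
      have h2 : IsOpen {p : (Fin k → ℝ) × (Fin k → ℝ) × (Fin k → ℝ) × ℝ × Z × Z |
          ∀ i, ‖z i - p.2.2.2.2.1‖ < p.2.2.1 i} := by
        simp only [Set.ofPred_forall]
        refine isOpen_iInter_of_finite fun i => ?_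
        exact isOpen_lt (by fun_prop) (by fun_prop)
      have h3 : IsOpen {p : (Fin k → ℝ) × (Fin k → ℝ) × (Fin k → ℝ) × ℝ × Z × Z |
          ‖∑ i, p.1 i • z i - p.2.2.2.2.2‖ < p.2.2.2.1} :=
        isOpen_lt (by fun_prop) (by fun_prop)
      exact h1.inter (h2.inter h3)
    obtain ⟨T, hT, hTU⟩ := TopologicalSpace.isOpen_iUnion_countable O hO
    refine ⟨T, hT, fun α r s t d e hd he ⟨z, hz⟩ => ?_⟩
    have hmem : ((α, r, s, t, ⟨d, hd⟩, ⟨e, he⟩) :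
        (Fin k → ℝ) × (Fin k → ℝ) × (Fin k → ℝ) × ℝ × Z × Z) ∈ ⋃ z, O z :=
      Set.mem_iUnion.2 ⟨z, hz⟩
    rw [← hTU] at hmem
    obtain ⟨z', hz'T, hz'⟩ := Set.mem_iUnion₂.1 hmem
    exact ⟨z', hz'T, hz'⟩
  choose T hT hTg using key
  let S : Set X := ⋃ k, ⋃ z ∈ T k, Set.range z
  have hS : S.Countable := Set.countable_iUnion fun k => (hT k).biUnion fun z _ => Set.countable_range z
  refine ⟨Submodule.span ℝ ((Z : Set X) ∪ S), ?_, ?_, ?_⟩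
  · exact fun x hx => Submodule.subset_span (Or.inl hx)
  · exact (hZ.union hS.isSeparable).span
  · intro k α r s t d e hd he hz
    obtain ⟨z, hzT, hg⟩ := hTg k α r s t d e hd he hz
    refine ⟨z, hg, fun i => Submodule.subset_span (Or.inr ?_)⟩
    exact Set.mem_iUnion.2 ⟨k, Set.mem_iUnion₂.2 ⟨z, hzT, i, rfl⟩⟩

lemma exists_elementary (φ : X → EReal) (S : Set X) (hS : S.Countable) :
    ∃ Y : Submodule ℝ X, S ⊆ Y ∧ IsClosed (Y : Set X) ∧ TopologicalSpace.IsSeparable (Y : Set X) ∧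
      ∀ (k : ℕ) (α r s : Fin k → ℝ) (t : ℝ) (d e : X), d ∈ Y → e ∈ Y →
        (∃ z, goodTuple φ k α r s t d e z) → ∃ z, goodTuple φ k α r s t d e z ∧ ∀ i, z i ∈ Y := by
  let A := {Z : Submodule ℝ X // TopologicalSpace.IsSeparable (Z : Set X)}
  have hstep : ∀ Z : A, ∃ Z' : A, Z.1 ≤ Z'.1 ∧
      ∀ (k : ℕ) (α r s : Fin k → ℝ) (t : ℝ) (d e : X), d ∈ Z.1 → e ∈ Z.1 →
        (∃ z, goodTuple φ k α r s t d e z) → ∃ z, goodTuple φ k α r s t d e z ∧ ∀ i, z i ∈ Z'.1 := by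
    intro Z
    obtain ⟨Z', h1, h2, h3⟩ := sep_step φ Z.1 Z.2
    exact ⟨⟨Z', h2⟩, h1, h3⟩
  choose nx hnx1 hnx2 using hstep
  let Z0 : A := ⟨Submodule.span ℝ S, hS.isSeparable.span⟩
  let W : ℕ → A := fun n => nx^[n] Z0
  have hW : ∀ n, W (n+1) = nx (W n) := fun n => Function.iterate_succ_apply' nx n Z0
  have hmono : Monotone fun n => (W n).1 := monotone_nat_of_le_succ fun n => by
    rw [hW]; exact hnx1 _
  have hcoe : ((⨆ n, (W n).1 : Submodule ℝ X) : Set X) = ⋃ n, ((W n).1 : Set X) :=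
    Submodule.coe_iSup_of_directed _ hmono.directed_le
  set V : Submodule ℝ X := ⨆ n, (W n).1 with hV
  have hVsep : TopologicalSpace.IsSeparable (V : Set X) := by
    rw [hcoe]; exact TopologicalSpace.IsSeparable.iUnion fun n => (W n).2
  refine ⟨V.topologicalClosure, ?_, V.isClosed_topologicalClosure, ?_, ?_⟩
  · intro x hx
    apply V.le_topologicalClosure
    exact (le_iSup (fun n => (W n).1) 0) (Submodule.subset_span hx)
  · rw [Submodule.topologicalClosure_coe]; exact hVsep.closure
  · rintro k α r s t d e hd he ⟨z, hz1, hz2, hz3⟩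
    obtain ⟨η, hη, hηs, hηt⟩ : ∃ η : ℝ, 0 < η ∧ (∀ i, ‖z i - d‖ + 2 * η < s i) ∧
        ‖∑ i, α i • z i - e‖ + 2 * η < t := by
      have h0 : Tendsto (fun η : ℝ => 2 * η) (𝓝[>] 0) (𝓝 0) := by
        have : Continuous fun η : ℝ => 2 * η := by fun_prop
        simpa using (this.tendsto 0).mono_left nhdsWithin_le_nhds
      have h1 : ∀ᶠ η : ℝ in 𝓝[>] 0, ∀ i, ‖z i - d‖ + 2 * η < s i := by
        rw [eventually_all]
        intro i
        filter_upwards [h0.eventually (gt_mem_nhds (sub_pos.2 (hz2 i)))] with η h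
        linarith
      have h2 : ∀ᶠ η : ℝ in 𝓝[>] 0, ‖∑ i, α i • z i - e‖ + 2 * η < t := by
        filter_upwards [h0.eventually (gt_mem_nhds (sub_pos.2 hz3))] with η h
        linarith
      obtain ⟨η, h⟩ := ((h1.and h2).and self_mem_nhdsWithin).exists
      exact ⟨η, h.2, h.1.1, h.1.2⟩
    obtain ⟨d', hd', hdd⟩ := Metric.mem_closure_iff.1 hd η hη
    obtain ⟨e', he', hee⟩ := Metric.mem_closure_iff.1 he η hη
    rw [dist_eq_norm] at hdd hee
    have hdd' : ‖d' - d‖ < η := by rwa [norm_sub_rev]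
    have hee' : ‖e' - e‖ < η := by rwa [norm_sub_rev]
    change d' ∈ (V : Set X) at hd'
    change e' ∈ (V : Set X) at he'
    rw [hcoe] at hd' he'
    obtain ⟨n1, hn1⟩ := Set.mem_iUnion.1 hd'
    obtain ⟨n2, hn2⟩ := Set.mem_iUnion.1 he'
    obtain ⟨z', ⟨g1, g2, g3⟩, hz'⟩ := hnx2 (W (max n1 n2)) k α r (fun i => s i - η) (t - η) d' e'
      (hmono (le_max_left _ _) hn1) (hmono (le_max_right _ _) hn2)
      ⟨z, hz1, fun i => by
        have := norm_sub_le_norm_sub_add_norm_sub (z i) d d'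
        linarith [hηs i], by
        have := norm_sub_le_norm_sub_add_norm_sub (∑ i, α i • z i) e e'
        linarith⟩
    refine ⟨z', ⟨g1, fun i => ?_, ?_⟩, fun i => ?_⟩
    · have := norm_sub_le_norm_sub_add_norm_sub (z' i) d' d
      linarith [g2 i]
    · have := norm_sub_le_norm_sub_add_norm_sub (∑ i, α i • z' i) e' e
      linarith
    · apply V.le_topologicalClosure
      refine (le_iSup (fun n => (W n).1) (max n1 n2 + 1)) ?_
      simp only [hW]
      exact hz' i

open scoped NNReal in
/-- Hahn–Banach: solvability of a system of linear inequalities by a bounded functional. -/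
lemma exists_functional (C : Submodule ℝ≥0 (X × ℝ)) (c : ℝ) (hc : 0 ≤ c)
    (h : ∀ q ∈ C, -(c * ‖q.1‖) ≤ q.2) :
    ∃ p : X →L[ℝ] ℝ, ∀ q ∈ C, p q.1 ≤ q.2 := by
  let V : X → Set ℝ := fun x => {b | ∃ q ∈ C, b = q.2 + c * ‖x - q.1‖}
  have hVne : ∀ x, (V x).Nonempty := fun x => ⟨_, 0, C.zero_mem, rfl⟩
  have hVb : ∀ x, ∀ b ∈ V x, -(c * ‖x‖) ≤ b := by
    rintro x b ⟨q, hq, rfl⟩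
    have h1 := h q hq
    have h2 : ‖q.1‖ ≤ ‖x‖ + ‖x - q.1‖ := by
      have := norm_sub_le x (x - q.1); simpa using this
    nlinarith
  have hVbd : ∀ x, BddBelow (V x) := fun x => ⟨_, fun b hb => hVb x b hb⟩
  let N : X → ℝ := fun x => sInf (V x)
  have hNle : ∀ x, ∀ q ∈ C, N x ≤ q.2 + c * ‖x - q.1‖ := fun x q hq =>
    csInf_le (hVbd x) ⟨q, hq, rfl⟩
  have hNhom1 : ∀ a : ℝ, 0 < a → ∀ x, N (a • x) ≤ a * N x := by
    intro a ha x
    rw [← div_le_iff₀' ha]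
    refine le_csInf (hVne x) ?_
    rintro b ⟨q, hq, rfl⟩
    rw [div_le_iff₀' ha]
    have h1 := hNle (a • x) ((⟨a, ha.le⟩ : ℝ≥0) • q) (C.smul_mem _ hq)
    have e1 : ((⟨a, ha.le⟩ : ℝ≥0) • q).1 = a • q.1 := rfl
    have e2 : ((⟨a, ha.le⟩ : ℝ≥0) • q).2 = a * q.2 := rfl
    rw [e1, e2, ← smul_sub, norm_smul, Real.norm_of_nonneg ha.le] at h1
    linarith
  have hNhom : ∀ a : ℝ, 0 < a → ∀ x, N (a • x) = a * N x := by
    intro a ha x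
    refine le_antisymm (hNhom1 a ha x) ?_
    have := hNhom1 a⁻¹ (inv_pos.2 ha) (a • x)
    rw [smul_smul, inv_mul_cancel₀ ha.ne', one_smul] at this
    rwa [← div_eq_inv_mul, le_div_iff₀' ha] at this
  have hNadd : ∀ x y, N (x + y) ≤ N x + N y := by
    intro x y
    rw [← sub_le_iff_le_add]
    refine le_csInf (hVne x) ?_
    rintro b ⟨q, hq, rfl⟩
    rw [sub_le_comm]
    refine le_csInf (hVne y) ?_
    rintro b ⟨q', hq', rfl⟩
    have h1 := hNle (x + y) (q + q') (C.add_mem hq hq')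
    have e : x + y - (q + q').1 = (x - q.1) + (y - q'.1) := by
      simp only [Prod.fst_add]; abel
    rw [e] at h1
    have h2 := norm_add_le (x - q.1) (y - q'.1)
    have h3 := mul_le_mul_of_nonneg_left h2 hc
    simp only [Prod.snd_add] at h1
    linarith
  obtain ⟨g, -, hg⟩ := exists_extension_of_le_sublinear (⊥ : X →ₗ.[ℝ] ℝ) N hNhom hNadd (by
    rintro ⟨x, hx⟩
    have hx0 : x = 0 := (Submodule.mem_bot ℝ).1 hx
    subst hx0
    have e : (⟨0, hx⟩ : (⊥ : X →ₗ.[ℝ] ℝ).domain) = 0 := rfl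
    rw [e, LinearPMap.map_zero]
    refine le_csInf (hVne _) fun b hb => ?_
    have := hVb _ b hb
    simpa using this)
  have hgc : ∀ x, g x ≤ c * ‖x‖ := fun x => by
    have := (hg x).trans (hNle x 0 C.zero_mem)
    simpa using this
  refine ⟨g.mkContinuous c fun x => ?_, fun q hq => ?_⟩
  · rw [Real.norm_eq_abs, abs_le]
    refine ⟨?_, hgc x⟩
    have := hgc (-x)
    rw [map_neg, norm_neg] at this
    linarith
  · have := (hg q.1).trans (hNle q.1 q hq)
    simpa using this

set_option maxHeartbeats 1000000 in
open scoped NNReal in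
/-- Separable reduction of Fréchet subdifferentiability. -/
lemma transfer (φ : X → EReal) (hnobot : ∀ x, φ x ≠ ⊥) (Y : Submodule ℝ X)
    (hY : ∀ (k : ℕ) (α r s : Fin k → ℝ) (t : ℝ) (d e : X), d ∈ Y → e ∈ Y →
        (∃ z, goodTuple φ k α r s t d e z) → ∃ z, goodTuple φ k α r s t d e z ∧ ∀ i, z i ∈ Y)
    (y w : Y) (p : Y →L[ℝ] ℝ) (hp : p ∈ FrechetSubdiff (fun x : Y => φ x) y) (hpw : 0 < p (w - y)) :
    ∃ P : X →L[ℝ] ℝ, P ∈ FrechetSubdiff φ y ∧ 0 < P ((w : X) - y) := by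
  obtain ⟨hfin, hp⟩ := hp
  change φ y ≠ ⊤ at hfin
  set f0 : ℝ := (φ y).toReal with hf0
  have hf0e : (f0 : EReal) = φ y := EReal.coe_toReal hfin (hnobot y)
  have hδ : ∀ n : ℕ, ∃ δ : ℝ, 0 < δ ∧ ∀ x : Y, ‖x - y‖ < δ → ∀ b : ℝ, φ x ≤ b →
      f0 + p (x - y) - 1 / ((n:ℝ) + 1) * ‖x - y‖ ≤ b := by
    intro n
    obtain ⟨δ, hδ, h⟩ := Metric.eventually_nhds_iff.1 (hp (1 / ((n:ℝ) + 1)) (by positivity))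
    refine ⟨δ, hδ, fun x hx b hb => ?_⟩
    have h1 := (h (y := x) (by rwa [dist_eq_norm])).trans hb
    beta_reduce at h1
    rw [← hf0e] at h1
    exact_mod_cast h1
  choose δ hδ0 hδ using hδ
  set σ : ℝ := p (w - y) with hσ
  -- the system of inequalities
  let A : Set (X × ℝ) := {q | ∃ n : ℕ, ‖q.1‖ < δ n ∧ ∃ b : ℝ, φ (y + q.1) ≤ b ∧
    q.2 = b - f0 + 1 / ((n:ℝ) + 1) * ‖q.1‖}
  let q0 : X × ℝ := ((y : X) - w, -σ)
  let C : Submodule ℝ≥0 (X × ℝ) := Submodule.span ℝ≥0 A ⊔ Submodule.span ℝ≥0 {q0}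
  have hC : ∀ q ∈ C, -((‖p‖ + 1) * ‖q.1‖) ≤ q.2 := by
    intro q hq
    obtain ⟨q1, hq1, q2, hq2, rfl⟩ := Submodule.mem_sup.1 hq
    obtain ⟨k, α, g, rfl⟩ := Submodule.mem_span_set'.1 hq1
    obtain ⟨a, rfl⟩ := Submodule.mem_span_singleton.1 hq2
    choose n hn b hb hq using fun i => (g i).2
    set h : Fin k → X := fun i => (g i).1.1 with hh
    have e1 : (∑ i, α i • (g i : X × ℝ) + a • q0).1 = ∑ i, (α i : ℝ) • h i + (a : ℝ) • ((y : X) - w) := by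
      simp only [Prod.fst_add, Prod.fst_sum, Prod.smul_fst]; rfl
    have e2 : (∑ i, α i • (g i : X × ℝ) + a • q0).2 =
        ∑ i, (α i : ℝ) * (b i - f0 + 1 / ((n i:ℝ) + 1) * ‖h i‖) - a * σ := by
      simp only [Prod.snd_add, Prod.snd_sum, Prod.smul_snd, hq]
      simp only [NNReal.smul_def, smul_eq_mul, q0, hh]; ring
    rw [e1, e2]
    by_contra hcon
    push Not at hcon
    set t0 := ‖∑ i, (α i : ℝ) • h i + (a : ℝ) • ((y : X) - w)‖ with ht0
    -- slack
    obtain ⟨ε, hε, hεδ, hεv⟩ : ∃ ε : ℝ, 0 < ε ∧ (∀ i, ‖h i‖ + ε < δ (n i)) ∧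
        ∑ i, (α i : ℝ) * (b i + ε - f0 + 1 / ((n i:ℝ) + 1) * (‖h i‖ + ε)) - a * σ
          < -((‖p‖ + 1) * (t0 + ε)) := by
      have h1 : ∀ᶠ ε : ℝ in 𝓝[>] 0, ∀ i, ‖h i‖ + ε < δ (n i) := by
        rw [eventually_all]
        intro i
        have hc : Continuous fun ε : ℝ => ‖h i‖ + ε := by fun_prop
        exact ((hc.tendsto 0).mono_left nhdsWithin_le_nhds).eventually
          (gt_mem_nhds (by simpa using hn i))
      have h2 : ∀ᶠ ε : ℝ in 𝓝[>] 0,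
          ∑ i, (α i : ℝ) * (b i + ε - f0 + 1 / ((n i:ℝ) + 1) * (‖h i‖ + ε)) - a * σ
            + ((‖p‖ + 1) * (t0 + ε)) < 0 := by
        have hc : Continuous fun ε : ℝ =>
          ∑ i, (α i : ℝ) * (b i + ε - f0 + 1 / ((n i:ℝ) + 1) * (‖h i‖ + ε)) - a * σ
            + ((‖p‖ + 1) * (t0 + ε)) := by fun_prop
        refine ((hc.tendsto 0).mono_left nhdsWithin_le_nhds).eventually (gt_mem_nhds ?_)
        simp only [add_zero]
        linarith
      obtain ⟨ε, h⟩ := ((h1.and h2).and self_mem_nhdsWithin).exists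
      exact ⟨ε, h.2, h.1.1, by linarith [h.1.2]⟩
    set e : Y := (∑ i, (α i : ℝ)) • y - (a : ℝ) • (y - w) with he
    have hsum : ∀ z : Fin k → X, ∑ i, (α i : ℝ) • z i - (e : X) =
        ∑ i, (α i : ℝ) • (z i - y) + (a : ℝ) • ((y : X) - w) := by
      intro z
      simp only [he, smul_sub, Finset.sum_sub_distrib, ← Finset.sum_smul, Submodule.coe_sub,
        Submodule.coe_smul]
      abel
    obtain ⟨z, ⟨g1, g2, g3⟩, hzY⟩ := hY k (fun i => α i) (fun i => b i + ε) (fun i => ‖h i‖ + ε)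
      (t0 + ε) y e y.2 e.2 ⟨fun i => y + h i, fun i => by
          refine lt_of_le_of_lt (hb i) ?_
          exact_mod_cast (by linarith : b i < b i + ε),
        fun i => by simpa using hε, by
          rw [hsum]
          simp only [add_sub_cancel_left]
          linarith⟩
    rw [hsum] at g3
    let z' : Fin k → Y := fun i => ⟨z i, hzY i⟩
    have k1 : ∀ i, p (z' i - y) ≤ b i + ε - f0 + 1 / ((n i:ℝ) + 1) * (‖h i‖ + ε) := by
      intro i
      have hzi : ‖z' i - y‖ < ‖h i‖ + ε := g2 i
      have := hδ (n i) (z' i) (hzi.trans (hεδ i)) (b i + ε) (g1 i).le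
      have h2 : 1 / ((n i:ℝ) + 1) * ‖z' i - y‖ ≤ 1 / ((n i:ℝ) + 1) * (‖h i‖ + ε) := by gcongr
      linarith
    set Q : Y := ∑ i, (α i : ℝ) • (z' i - y) + (a : ℝ) • (y - w) with hQ
    have k2 : ‖Q‖ < t0 + ε := by
      have : ((Q : Y) : X) = ∑ i, (α i : ℝ) • (z i - y) + (a : ℝ) • ((y : X) - w) := by
        simp [hQ, z']
      rw [← this] at g3
      exact g3
    have k3 : p Q = ∑ i, (α i : ℝ) * p (z' i - y) - a * σ := by
      have : p (y - w) = -σ := by rw [hσ, ← map_neg]; simp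
      rw [hQ, map_add, map_sum, map_smul, this]
      simp only [map_smul, smul_eq_mul]
      ring
    have k4 : ∑ i, (α i : ℝ) * p (z' i - y) ≤
        ∑ i, (α i : ℝ) * (b i + ε - f0 + 1 / ((n i:ℝ) + 1) * (‖h i‖ + ε)) :=
      Finset.sum_le_sum fun i _ => mul_le_mul_of_nonneg_left (k1 i) (α i).2
    have k5 := (neg_le_abs _).trans (p.le_opNorm Q)
    nlinarith [norm_nonneg p, norm_nonneg Q]
  obtain ⟨P, hP⟩ := exists_functional C (‖p‖ + 1) (by positivity) hC
  refine ⟨P, ⟨hfin, ?_⟩, ?_⟩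
  · intro ε hε
    obtain ⟨n, hn⟩ := exists_nat_one_div_lt hε
    refine Metric.eventually_nhds_iff.2 ⟨δ n, hδ0 n, fun x hx => ?_⟩
    rw [dist_eq_norm] at hx
    by_cases hxt : φ x = ⊤
    · rw [hxt]; exact le_top
    have hxe : (((φ x).toReal : ℝ) : EReal) = φ x := EReal.coe_toReal hxt (hnobot x)
    have h1 := hP (x - y, (φ x).toReal - f0 + 1 / ((n:ℝ) + 1) * ‖x - y‖)
      (Submodule.mem_sup_left (Submodule.subset_span
        ⟨n, hx, (φ x).toReal, by simp [hxe], rfl⟩))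
    simp only at h1
    have h2 : 1 / ((n:ℝ) + 1) * ‖x - y‖ ≤ ε * ‖x - y‖ := by gcongr
    rw [← hxe, ← hf0e]
    exact_mod_cast (by linarith : f0 + P (x - y) - ε * ‖x - y‖ ≤ (φ x).toReal)
  · have h1 := hP q0 (Submodule.mem_sup_right (Submodule.mem_span_singleton_self q0))
    simp only [q0] at h1
    have : P ((w : X) - y) = - P ((y : X) - w) := by rw [← map_neg]; simp
    linarith
end
end ThreePointsAux4

/-- Lemma 2.4 (three-points lemma): in an Asplund space, if `v ∈ [u,w]` and
`φ v > φ u`, then for any `λ > 0` there are `x̄ ∈ dom φ` and `x̄* ∈ ∂̂φ(x̄)` with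
`x̄ ∈ B_λ([u,v])` and `⟨x̄*, w - x̄⟩ > 0`. -/
theorem three_points_lemma
    {X : Type*} [NormedAddCommGroup X] [NormedSpace ℝ X] [CompleteSpace X]
    (hX : IsAsplund X) (φ : X → EReal)
    (hproper : ∃ x, φ x ≠ ⊤) (hnobot : ∀ x, φ x ≠ ⊥)
    (hlsc : LowerSemicontinuous φ)
    (u v w : X) (hv : v ∈ segment ℝ u w) (hφ : φ u < φ v) (l : ℝ) (hl : 0 < l) :
    ∃ (xb : X) (xbs : X →L[ℝ] ℝ), φ xb ≠ ⊤ ∧ xbs ∈ FrechetSubdiff φ xb ∧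
      (∃ y ∈ segment ℝ u v, ‖xb - y‖ < l) ∧ 0 < xbs (w - xb) := by
  obtain ⟨Y, hSY, hYc, hYs, hY⟩ := exists_elementary φ ({u, v, w} : Set X) (Set.toFinite _).countable
  haveI : TopologicalSpace.SeparableSpace Y := hYs.separableSpace
  haveI := hX Y hYc inferInstance
  haveI : CompleteSpace Y := hYc.completeSpace_coe
  let u' : Y := ⟨u, hSY (by simp)⟩
  let v' : Y := ⟨v, hSY (by simp)⟩
  let w' : Y := ⟨w, hSY (by simp)⟩
  have hv' : v' ∈ segment ℝ u' w' := by
    obtain ⟨a, b, ha, hb, hab, h⟩ := hv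
    exact ⟨a, b, ha, hb, hab, Subtype.ext h⟩
  obtain ⟨xb, p, h1, h2, ⟨y, hy, hyl⟩, h4⟩ := three_points_sep (fun x : Y => φ x) (fun x => hnobot x)
    (fun x y hy => continuous_subtype_val.continuousAt.eventually (hlsc (x : X) y hy)) u' v' w' hv' hφ l hl
  obtain ⟨P, hP, hPw⟩ := transfer φ hnobot Y hY xb w' p h2 h4
  refine ⟨xb, P, h1, hP, ⟨y, ?_, hyl⟩, hPw⟩
  obtain ⟨a, b, ha, hb, hab, h⟩ := hy
  exact ⟨a, b, ha, hb, hab, congrArg Subtype.val h⟩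
end
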